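/- Heap subject reduction: if the well-resolved relation H ⊢ a ~ b ~ c : A holds, H is a wr-heap, and there is a heap reduction H; c ~~> H'; c', then there exist terms a' and b' such that H' ⊢ a' ~ b' ~ c' : A holds, H' is a wr-heap, a program-reduces in zero or more steps to a', and b program-reduces in zero or more steps to b'. -/

import Mathlib

namespace TLL

/-- The two sorts of TLL: `U` (non-linear) and `L` (linear). -/
inductive Srt : Type
  | U | L
deriving DecidableEq

/-- TLL terms in de Bruijn representation: variables, sorts, the two Π-type
formers (irrelevant `pi0` and relevant `pi1`), the two λ-formers, application,
the erased constant `box`, and heap pointers `ptr`. -/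
inductive Tm : Type
  | var  : Nat → Tm
  | srt  : Srt → Tm
  | pi0  : Srt → Tm → Tm → Tm
  | pi1  : Srt → Tm → Tm → Tm
  | lam0 : Srt → Tm → Tm → Tm
  | lam1 : Srt → Tm → Tm → Tm
  | app  : Tm → Tm → Tm
  | box  : Tm
  | ptr  : Nat → Tm

def upr (ξ : Nat → Nat) : Nat → Nat
  | 0 => 0
  | n + 1 => ξ n + 1

def rename (ξ : Nat → Nat) : Tm → Tm
  | .var x => .var (ξ x)
  | .srt s => .srt s
  | .pi0 t A B => .pi0 t (rename ξ A) (rename (upr ξ) B)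
  | .pi1 t A B => .pi1 t (rename ξ A) (rename (upr ξ) B)
  | .lam0 t A m => .lam0 t (rename ξ A) (rename (upr ξ) m)
  | .lam1 t A m => .lam1 t (rename ξ A) (rename (upr ξ) m)
  | .app m n => .app (rename ξ m) (rename ξ n)
  | .box => .box
  | .ptr l => .ptr l

def up (σ : Nat → Tm) : Nat → Tm
  | 0 => .var 0
  | n + 1 => rename Nat.succ (σ n)

def subst (σ : Nat → Tm) : Tm → Tm
  | .var x => σ x
  | .srt s => .srt s
  | .pi0 t A B => .pi0 t (subst σ A) (subst (up σ) B)
  | .pi1 t A B => .pi1 t (subst σ A) (subst (up σ) B)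
  | .lam0 t A m => .lam0 t (subst σ A) (subst (up σ) m)
  | .lam1 t A m => .lam1 t (subst σ A) (subst (up σ) m)
  | .app m n => .app (subst σ m) (subst σ n)
  | .box => .box
  | .ptr l => .ptr l

/-- `subst1 n m` is `m[n/x]` for the topmost bound variable `x`. -/
def subst1 (n : Tm) (m : Tm) : Tm :=
  subst (fun i => match i with | 0 => n | i + 1 => .var i) m

/-- Logical one-step reduction `m ~> n`: full β-reduction with both β-rules,
closed under all structural subterm positions. -/
inductive LStep : Tm → Tm → Prop
  | beta0 {t A m n} : LStep (.app (.lam0 t A m) n) (subst1 n m)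
  | beta1 {t A m n} : LStep (.app (.lam1 t A m) n) (subst1 n m)
  | appL {m m' n} : LStep m m' → LStep (.app m n) (.app m' n)
  | appR {m n n'} : LStep n n' → LStep (.app m n) (.app m n')
  | pi0A {t A A' B} : LStep A A' → LStep (.pi0 t A B) (.pi0 t A' B)
  | pi0B {t A B B'} : LStep B B' → LStep (.pi0 t A B) (.pi0 t A B')
  | pi1A {t A A' B} : LStep A A' → LStep (.pi1 t A B) (.pi1 t A' B)
  | pi1B {t A B B'} : LStep B B' → LStep (.pi1 t A B) (.pi1 t A B')
  | lam0A {t A A' m} : LStep A A' → LStep (.lam0 t A m) (.lam0 t A' m)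
  | lam0M {t A m m'} : LStep m m' → LStep (.lam0 t A m) (.lam0 t A m')
  | lam1A {t A A' m} : LStep A A' → LStep (.lam1 t A m) (.lam1 t A' m)
  | lam1M {t A m m'} : LStep m m' → LStep (.lam1 t A m) (.lam1 t A m')

/-- Multi-step logical reduction. -/
abbrev LRed : Tm → Tm → Prop := Relation.ReflTransGen LStep

/-- Definitional equality `A ≃ B`: equivalence closure of logical reduction. -/
def Conv (A B : Tm) : Prop := Relation.EqvGen LStep A B

/-- Parallel logical reduction `m ⇒ n`. -/
inductive PStep : Tm → Tm → Prop
  | var {x} : PStep (.var x) (.var x)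
  | srt {s} : PStep (.srt s) (.srt s)
  | box : PStep .box .box
  | ptr {l} : PStep (.ptr l) (.ptr l)
  | pi0 {t A A' B B'} : PStep A A' → PStep B B' → PStep (.pi0 t A B) (.pi0 t A' B')
  | pi1 {t A A' B B'} : PStep A A' → PStep B B' → PStep (.pi1 t A B) (.pi1 t A' B')
  | lam0 {t A A' m m'} : PStep A A' → PStep m m' → PStep (.lam0 t A m) (.lam0 t A' m')
  | lam1 {t A A' m m'} : PStep A A' → PStep m m' → PStep (.lam1 t A m) (.lam1 t A' m')
  | app {m m' n n'} : PStep m m' → PStep n n' → PStep (.app m n) (.app m' n')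
  | beta0 {t A m m' n n'} : PStep m m' → PStep n n' →
      PStep (.app (.lam0 t A m) n) (subst1 n' m')
  | beta1 {t A m m' n n'} : PStep m m' → PStep n n' →
      PStep (.app (.lam1 t A m) n) (subst1 n' m')

/-- Logical contexts: lists of types (de Bruijn). -/
abbrev Ctx := List Tm

/-- `Has Γ x A`: variable `x` has type `A` in logical context `Γ`
(with the appropriate de Bruijn shifts). -/
inductive Has : Ctx → Nat → Tm → Prop
  | zero {Γ A} : Has (A :: Γ) 0 (rename Nat.succ A)
  | succ {Γ x A B} : Has Γ x A → Has (B :: Γ) (x + 1) (rename Nat.succ A)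

mutual
/-- Well-formed logical contexts. -/
inductive LWf : Ctx → Prop
  | nil : LWf []
  | cons {Γ A s} : LWf Γ → LTyped Γ A (.srt s) → LWf (A :: Γ)

/-- The logical typing judgment `Γ ⊢ m : A`. -/
inductive LTyped : Ctx → Tm → Tm → Prop
  | srt {Γ} (s : Srt) : LWf Γ → LTyped Γ (.srt s) (.srt .U)
  | var {Γ x A} : LWf Γ → Has Γ x A → LTyped Γ (.var x) A
  | pi0 {Γ A B s r} (t : Srt) :
      LTyped Γ A (.srt s) → LTyped (A :: Γ) B (.srt r) →
      LTyped Γ (.pi0 t A B) (.srt t)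
  | pi1 {Γ A B s r} (t : Srt) :
      LTyped Γ A (.srt s) → LTyped (A :: Γ) B (.srt r) →
      LTyped Γ (.pi1 t A B) (.srt t)
  | lam0 {Γ A B m} (t : Srt) :
      LTyped (A :: Γ) m B → LTyped Γ (.lam0 t A m) (.pi0 t A B)
  | lam1 {Γ A B m} (t : Srt) :
      LTyped (A :: Γ) m B → LTyped Γ (.lam1 t A m) (.pi1 t A B)
  | app0 {Γ m n A B t} :
      LTyped Γ m (.pi0 t A B) → LTyped Γ n A → LTyped Γ (.app m n) (subst1 n B)
  | app1 {Γ m n A B t} :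
      LTyped Γ m (.pi1 t A B) → LTyped Γ n A → LTyped Γ (.app m n) (subst1 n B)
  | conv {Γ m A B s} :
      LTyped Γ m A → LTyped Γ B (.srt s) → Conv A B → LTyped Γ m B
end

/-- Program context entries: either absent, or a sort-annotated type. -/
abbrev Entry := Option (Srt × Tm)

/-- Program contexts, positionally aligned with the logical context. -/
abbrev PCtx := List Entry

/-- The context constraint `Δ ▷ s`. -/
inductive Restr : PCtx → Srt → Prop
  | nil {s} : Restr [] s
  | skip {Δ s} : Restr Δ s → Restr ((none : Entry) :: Δ) s
  | u {Δ A} : Restr Δ .U → Restr (some (.U, A) :: Δ) .U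
  | l {Δ s A} : Restr Δ .L → Restr (some (s, A) :: Δ) .L

/-- Context merge `Δ₁ ∪̇ Δ₂ = Δ`: contraction on shared `U` entries,
`L` entries occur on exactly one side. -/
inductive Merge : PCtx → PCtx → PCtx → Prop
  | nil : Merge [] [] []
  | contra {Δ₁ Δ₂ Δ A} : Merge Δ₁ Δ₂ Δ →
      Merge (some (.U, A) :: Δ₁) (some (.U, A) :: Δ₂) (some (.U, A) :: Δ)
  | left {Δ₁ Δ₂ Δ A} : Merge Δ₁ Δ₂ Δ →
      Merge (some (.L, A) :: Δ₁) ((none : Entry) :: Δ₂) (some (.L, A) :: Δ)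
  | right {Δ₁ Δ₂ Δ A} : Merge Δ₁ Δ₂ Δ →
      Merge ((none : Entry) :: Δ₁) (some (.L, A) :: Δ₂) (some (.L, A) :: Δ)
  | skip {Δ₁ Δ₂ Δ} : Merge Δ₁ Δ₂ Δ →
      Merge ((none : Entry) :: Δ₁) ((none : Entry) :: Δ₂) ((none : Entry) :: Δ)

/-- `PHas Δ x s A`: the entry `x :s A` occurs in `Δ` and the rest of `Δ`
satisfies `▷ U` (so no linear entry is discarded). -/
inductive PHas : PCtx → Nat → Srt → Tm → Prop
  | zero {Δ s A} : Restr Δ .U → PHas (some (s, A) :: Δ) 0 s (rename Nat.succ A)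
  | succN {Δ x s A} : PHas Δ x s A → PHas ((none : Entry) :: Δ) (x + 1) s (rename Nat.succ A)
  | succU {Δ x s A B} : PHas Δ x s A → PHas (some (.U, B) :: Δ) (x + 1) s (rename Nat.succ A)

/-- Well-formed pairs of logical and program contexts `Γ ; Δ ⊢`. -/
inductive PWf : Ctx → PCtx → Prop
  | nil : PWf [] []
  | cons {Γ Δ A s} : PWf Γ Δ → LTyped Γ A (.srt s) → PWf (A :: Γ) (some (s, A) :: Δ)
  | consN {Γ Δ A s} : PWf Γ Δ → LTyped Γ A (.srt s) → PWf (A :: Γ) ((none : Entry) :: Δ)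

/-- The program typing judgment `Γ ; Δ ⊢ m : A`. -/
inductive PTyped : Ctx → PCtx → Tm → Tm → Prop
  | var {Γ Δ x s A} : PWf Γ Δ → PHas Δ x s A → PTyped Γ Δ (.var x) A
  | lam0 {Γ Δ A B m} (t : Srt) :
      PTyped (A :: Γ) ((none : Entry) :: Δ) m B → Restr Δ t →
      PTyped Γ Δ (.lam0 t A m) (.pi0 t A B)
  | lam1 {Γ Δ A B m s} (t : Srt) :
      PTyped (A :: Γ) (some (s, A) :: Δ) m B → Restr Δ t →
      PTyped Γ Δ (.lam1 t A m) (.pi1 t A B)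
  | app0 {Γ Δ m n A B t} :
      PTyped Γ Δ m (.pi0 t A B) → LTyped Γ n A →
      PTyped Γ Δ (.app m n) (subst1 n B)
  | app1 {Γ Δ₁ Δ₂ Δ m n A B t} :
      PTyped Γ Δ₁ m (.pi1 t A B) → PTyped Γ Δ₂ n A → Merge Δ₁ Δ₂ Δ →
      PTyped Γ Δ (.app m n) (subst1 n B)
  | conv {Γ Δ m A B s} :
      PTyped Γ Δ m A → LTyped Γ B (.srt s) → Conv A B →
      PTyped Γ Δ m B

/-- Program values. -/
inductive Value : Tm → Prop
  | var {x} : Value (.var x)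
  | lam0 {t A m} : Value (.lam0 t A m)
  | lam1 {t A m} : Value (.lam1 t A m)

/-- Program (call-by-value) one-step reduction `m ~~> n`. -/
inductive CStep : Tm → Tm → Prop
  | appL {m m' n} : CStep m m' → CStep (.app m n) (.app m' n)
  | appR {m n n'} : CStep n n' → CStep (.app m n) (.app m n')
  | beta0 {t A m n} : CStep (.app (.lam0 t A m) n) (subst1 n m)
  | beta1 {t A m v} : Value v → CStep (.app (.lam1 t A m) v) (subst1 v m)

/-- The erasure judgment `Γ ; Δ ⊢ m ~ m' : A`. -/
inductive Erase : Ctx → PCtx → Tm → Tm → Tm → Prop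
  | var {Γ Δ x s A} : PWf Γ Δ → PHas Δ x s A → Erase Γ Δ (.var x) (.var x) A
  | lam0 {Γ Δ A B m m'} (t : Srt) :
      Erase (A :: Γ) ((none : Entry) :: Δ) m m' B → Restr Δ t →
      Erase Γ Δ (.lam0 t A m) (.lam0 t .box m') (.pi0 t A B)
  | lam1 {Γ Δ A B m m' s} (t : Srt) :
      Erase (A :: Γ) (some (s, A) :: Δ) m m' B → Restr Δ t →
      Erase Γ Δ (.lam1 t A m) (.lam1 t .box m') (.pi1 t A B)
  | app0 {Γ Δ m m' n A B t} :
      Erase Γ Δ m m' (.pi0 t A B) → LTyped Γ n A →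
      Erase Γ Δ (.app m n) (.app m' .box) (subst1 n B)
  | app1 {Γ Δ₁ Δ₂ Δ m m' n n' A B t} :
      Erase Γ Δ₁ m m' (.pi1 t A B) → Erase Γ Δ₂ n n' A → Merge Δ₁ Δ₂ Δ →
      Erase Γ Δ (.app m n) (.app m' n') (subst1 n B)
  | conv {Γ Δ m m' A B s} :
      Erase Γ Δ m m' A → LTyped Γ B (.srt s) → Conv A B →
      Erase Γ Δ m m' B

/-- Heaps: finite maps from locations to sort-annotated values. -/
abbrev Heap := Nat → Option (Srt × Tm)

/-- Heap lookup `Lookup H₁ l v H₂`: non-linear cells persist, linear cells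
are deallocated. -/
inductive Lookup : Heap → Nat → Tm → Heap → Prop
  | u {H l v} : H l = some (.U, v) → Lookup H l v H
  | l {H l v} : H l = some (.L, v) → Lookup H l v (Function.update H l none)

/-- Heap merge `H₁ ∪̇ H₂ = H`. -/
def HMerge (H₁ H₂ H : Heap) : Prop := ∀ l,
  (H₁ l = none ∧ H₂ l = none ∧ H l = none) ∨
  (∃ v, H₁ l = some (.U, v) ∧ H₂ l = some (.U, v) ∧ H l = some (.U, v)) ∨
  (∃ v, H₁ l = some (.L, v) ∧ H₂ l = none ∧ H l = some (.L, v)) ∨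
  (∃ v, H₁ l = none ∧ H₂ l = some (.L, v) ∧ H l = some (.L, v))

/-- The heap constraint `H ▷ s`. -/
def HRestr (H : Heap) : Srt → Prop
  | .U => ∀ l s v, H l = some (s, v) → s = Srt.U
  | .L => True

/-- Heap reduction `H ; m ~~> H' ; m'`. -/
inductive HStep : Heap → Tm → Heap → Tm → Prop
  | alloc0 {H l t m} : H l = none →
      HStep H (.lam0 t .box m) (Function.update H l (some (t, .lam0 t .box m))) (.ptr l)
  | alloc1 {H l t m} : H l = none →
      HStep H (.lam1 t .box m) (Function.update H l (some (t, .lam1 t .box m))) (.ptr l)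
  | appL {H H' m m' n} : HStep H m H' m' → HStep H (.app m n) H' (.app m' n)
  | appR {H H' m n n'} : HStep H n H' n' → HStep H (.app m n) H' (.app m n')
  | beta0 {H H' l t m n} : Lookup H l (.lam0 t .box m) H' →
      HStep H (.app (.ptr l) n) H' (subst1 .box m)
  | beta1 {H H' l₁ l₂ t m} : Lookup H l₁ (.lam1 t .box m) H' →
      HStep H (.app (.ptr l₁) (.ptr l₂)) H' (subst1 (.ptr l₂) m)

/-- Pointer resolution `H ; m ~ n`. -/
inductive Resolve : Heap → Tm → Tm → Prop
  | var {H x} : HRestr H .U → Resolve H (.var x) (.var x)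
  | lam0 {H t m' m} : HRestr H t → Resolve H m' m →
      Resolve H (.lam0 t .box m') (.lam0 t .box m)
  | lam1 {H t m' m} : HRestr H t → Resolve H m' m →
      Resolve H (.lam1 t .box m') (.lam1 t .box m)
  | app0 {H m' m} : Resolve H m' m → Resolve H (.app m' .box) (.app m .box)
  | app1 {H₁ H₂ H m' m n' n} : HMerge H₁ H₂ H →
      Resolve H₁ m' m → Resolve H₂ n' n → Resolve H (.app m' n') (.app m n)
  | ptr {H H' l v' v} : Lookup H l v' H' → Resolve H' v' v → Resolve H (.ptr l) v

/-- `ClosedUnder k m`: all free de Bruijn variables of `m` are `< k`. -/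
def ClosedUnder : Nat → Tm → Prop
  | k, .var x => x < k
  | _, .srt _ => True
  | k, .pi0 _ A B => ClosedUnder k A ∧ ClosedUnder (k + 1) B
  | k, .pi1 _ A B => ClosedUnder k A ∧ ClosedUnder (k + 1) B
  | k, .lam0 _ A m => ClosedUnder k A ∧ ClosedUnder (k + 1) m
  | k, .lam1 _ A m => ClosedUnder k A ∧ ClosedUnder (k + 1) m
  | k, .app m n => ClosedUnder k m ∧ ClosedUnder k n
  | _, .box => True
  | _, .ptr _ => True

/-- WR-heaps: heaps plausibly produced by heap reduction. -/
inductive WrHeap : Heap → Prop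
  | nil : WrHeap (fun _ => none)
  | lam0 {H l t m} : ClosedUnder 1 m → WrHeap H → H l = none →
      WrHeap (Function.update H l (some (t, .lam0 t .box m)))
  | lam1 {H l t m} : ClosedUnder 1 m → WrHeap H → H l = none →
      WrHeap (Function.update H l (some (t, .lam1 t .box m)))

/-- Well-resolved `H ⊢ a ~ b ~ c : A`. -/
def WellResolved (H : Heap) (a b c A : Tm) : Prop :=
  Erase [] [] a b A ∧ Resolve H c b


/-! ### Substitution algebra -/

theorem upr_id : upr id = id := by
  funext x; cases x <;> rfl

theorem rename_id (m : Tm) : rename id m = m := by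
  induction m <;> simp_all [rename, upr_id]

theorem up_var : up Tm.var = Tm.var := by
  funext x; cases x <;> rfl

theorem subst_var (m : Tm) : subst Tm.var m = m := by
  induction m <;> simp_all [subst, up_var]

theorem up_comp_upr (σ : Nat → Tm) (ξ : Nat → Nat) :
    up σ ∘ upr ξ = up (σ ∘ ξ) := by
  funext x; cases x <;> rfl

theorem subst_rename (m : Tm) : ∀ (σ : Nat → Tm) (ξ : Nat → Nat),
    subst σ (rename ξ m) = subst (σ ∘ ξ) m := by
  induction m <;> intro σ ξ <;> simp_all [rename, subst, up_comp_upr]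

theorem rename_eq_subst (m : Tm) : ∀ ξ : Nat → Nat,
    rename ξ m = subst (Tm.var ∘ ξ) m := by
  have hup : ∀ ξ : Nat → Nat, up (Tm.var ∘ ξ) = Tm.var ∘ upr ξ := by
    intro ξ; funext x; cases x <;> rfl
  induction m <;> intro ξ <;> simp_all [rename, subst]

theorem rename_rename (m : Tm) (ξ ζ : Nat → Nat) :
    rename ζ (rename ξ m) = rename (ζ ∘ ξ) m := by
  rw [rename_eq_subst (rename ξ m), subst_rename, rename_eq_subst m]; rfl

theorem rename_subst (m : Tm) : ∀ (σ : Nat → Tm) (ξ : Nat → Nat),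
    rename ξ (subst σ m) = subst (rename ξ ∘ σ) m := by
  have hup : ∀ (σ : Nat → Tm) (ξ : Nat → Nat),
      up (rename ξ ∘ σ) = rename (upr ξ) ∘ up σ := by
    intro σ ξ; funext x
    cases x with
    | zero => rfl
    | succ x => simp only [up, Function.comp, rename_rename]; rfl
  induction m <;> intro σ ξ <;> simp_all [rename, subst]

theorem subst_subst (m : Tm) : ∀ σ τ : Nat → Tm,
    subst τ (subst σ m) = subst (subst τ ∘ σ) m := by
  have hup : ∀ σ τ : Nat → Tm, up (subst τ ∘ σ) = subst (up τ) ∘ up σ := by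
    intro σ τ; funext x
    cases x with
    | zero => rfl
    | succ x => simp only [up, Function.comp, rename_subst, subst_rename]; rfl
  induction m <;> intro σ τ <;> simp_all [subst]

/-- The substitution sending `0` to `n` and shifting the other variables down. -/
def inst (n : Tm) : Nat → Tm
  | 0 => n
  | i + 1 => .var i

theorem subst1_eq (n m : Tm) : subst1 n m = subst (inst n) m := by
  unfold subst1
  congr 1

theorem subst_inst_rename (n m : Tm) : subst (inst n) (rename Nat.succ m) = m := by
  rw [subst_rename]; exact subst_var m

theorem subst_subst1 (σ : Nat → Tm) (n m : Tm) :
    subst σ (subst1 n m) = subst1 (subst σ n) (subst (up σ) m) := by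
  simp only [subst1_eq, subst_subst]
  congr 1; funext x
  cases x with
  | zero => rfl
  | succ x => simp only [Function.comp, up, subst_inst_rename]; rfl

theorem rename_subst1 (ξ : Nat → Nat) (n m : Tm) :
    rename ξ (subst1 n m) = subst1 (rename ξ n) (rename (upr ξ) m) := by
  simp only [subst1_eq, rename_subst, subst_rename]
  congr 1; funext x; cases x <;> rfl

theorem subst_up_rename_succ (σ : Nat → Tm) (m : Tm) :
    subst (up σ) (rename Nat.succ m) = rename Nat.succ (subst σ m) := by
  rw [subst_rename, rename_subst]; rfl

theorem rename_upr_rename_succ (ξ : Nat → Nat) (m : Tm) :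
    rename (upr ξ) (rename Nat.succ m) = rename Nat.succ (rename ξ m) := by
  rw [rename_rename, rename_rename]; rfl

/-! ### Confluence of logical reduction -/

theorem LStep.subst {m m' : Tm} (h : LStep m m') :
    ∀ σ : Nat → Tm, LStep (TLL.subst σ m) (TLL.subst σ m') := by
  induction h <;> intro σ <;> simp only [TLL.subst, subst_subst1] <;> constructor <;>
    rename_i ih <;> exact ih _

theorem PStep.refl : ∀ m : Tm, PStep m m := by
  intro m; induction m <;> constructor <;> assumption

theorem PStep.rename {m m' : Tm} (h : PStep m m') :
    ∀ ξ : Nat → Nat, PStep (TLL.rename ξ m) (TLL.rename ξ m') := by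
  induction h <;> intro ξ <;> simp only [TLL.rename, rename_subst1] <;> constructor <;>
    apply_assumption

theorem PStep.up {σ τ : Nat → Tm} (h : ∀ x, PStep (σ x) (τ x)) :
    ∀ x, PStep (TLL.up σ x) (TLL.up τ x)
  | 0 => .var
  | x + 1 => (h x).rename _

theorem PStep.subst {m m' : Tm} (h : PStep m m') :
    ∀ {σ τ : Nat → Tm}, (∀ x, PStep (σ x) (τ x)) →
      PStep (TLL.subst σ m) (TLL.subst τ m') := by
  induction h <;> intro σ τ hs <;> simp only [TLL.subst, subst_subst1]
  case var => exact hs _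
  all_goals constructor
  all_goals first
    | (rename_i ih; exact ih hs)
    | (rename_i ih; exact ih (PStep.up hs))
    | (rename_i ih _; exact ih hs)
    | (rename_i ih _; exact ih (PStep.up hs))

theorem PStep.subst1 {m m' n n' : Tm} (hm : PStep m m') (hn : PStep n n') :
    PStep (TLL.subst1 n m) (TLL.subst1 n' m') := by
  rw [subst1_eq, subst1_eq]
  refine hm.subst fun x => ?_
  cases x with
  | zero => exact hn
  | succ x => exact .var

theorem LStep.pstep {m m' : Tm} (h : LStep m m') : PStep m m' := by
  induction h
  case beta0 => exact .beta0 (.refl _) (.refl _)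
  case beta1 => exact .beta1 (.refl _) (.refl _)
  all_goals constructor <;> first | assumption | exact PStep.refl _

theorem PStep.lred {m m' : Tm} (h : PStep m m') : LRed m m' := by
  have two : ∀ {f : Tm → Tm → Tm} {a a' b b'},
      (∀ a a' b, LStep a a' → LStep (f a b) (f a' b)) →
      (∀ a b b', LStep b b' → LStep (f a b) (f a b')) →
      LRed a a' → LRed b b' → LRed (f a b) (f a' b') := fun h₁ h₂ ha hb =>
    (ha.lift (fun x => _) (fun _ _ h => h₁ _ _ _ h)).trans
      (hb.lift (fun x => _) (fun _ _ h => h₂ _ _ _ h))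
  have happ : ∀ {a a' b b'}, LRed a a' → LRed b b' → LRed (.app a b) (.app a' b') :=
    two (fun _ _ _ h => .appL h) (fun _ _ _ h => .appR h)
  induction h with
  | var | srt | box | ptr => exact .refl
  | pi0 _ _ ih₁ ih₂ => exact two (fun _ _ _ h => .pi0A h) (fun _ _ _ h => .pi0B h) ih₁ ih₂
  | pi1 _ _ ih₁ ih₂ => exact two (fun _ _ _ h => .pi1A h) (fun _ _ _ h => .pi1B h) ih₁ ih₂
  | lam0 _ _ ih₁ ih₂ => exact two (fun _ _ _ h => .lam0A h) (fun _ _ _ h => .lam0M h) ih₁ ih₂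
  | lam1 _ _ ih₁ ih₂ => exact two (fun _ _ _ h => .lam1A h) (fun _ _ _ h => .lam1M h) ih₁ ih₂
  | app _ _ ih₁ ih₂ => exact happ ih₁ ih₂
  | beta0 _ _ ih₁ ih₂ =>
    exact (happ (ih₁.lift _ fun _ _ h => .lam0M h) ih₂).tail .beta0
  | beta1 _ _ ih₁ ih₂ =>
    exact (happ (ih₁.lift _ fun _ _ h => .lam1M h) ih₂).tail .beta1

/-- Complete development: contract all redexes of a term simultaneously. -/
def develop : Tm → Tm
  | .var x => .var x
  | .srt s => .srt s
  | .pi0 t A B => .pi0 t (develop A) (develop B)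
  | .pi1 t A B => .pi1 t (develop A) (develop B)
  | .lam0 t A m => .lam0 t (develop A) (develop m)
  | .lam1 t A m => .lam1 t (develop A) (develop m)
  | .app (.lam0 _ _ m) n => subst1 (develop n) (develop m)
  | .app (.lam1 _ _ m) n => subst1 (develop n) (develop m)
  | .app m n => .app (develop m) (develop n)
  | .box => .box
  | .ptr l => .ptr l

theorem PStep.develop {m m' : Tm} (h : PStep m m') : PStep m' (develop m) := by
  induction h with
  | var | srt | box | ptr => exact .refl _
  | pi0 _ _ ih₁ ih₂ => exact .pi0 ih₁ ih₂
  | pi1 _ _ ih₁ ih₂ => exact .pi1 ih₁ ih₂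
  | lam0 _ _ ih₁ ih₂ => exact .lam0 ih₁ ih₂
  | lam1 _ _ ih₁ ih₂ => exact .lam1 ih₁ ih₂
  | beta0 _ _ ih₁ ih₂ => exact ih₁.subst1 ih₂
  | beta1 _ _ ih₁ ih₂ => exact ih₁.subst1 ih₂
  | @app m m' n n' h₁ _ ih₁ ih₂ =>
    cases m
    case lam0 =>
      cases h₁; cases ih₁
      exact .beta0 (by assumption) ih₂
    case lam1 =>
      cases h₁; cases ih₁
      exact .beta1 (by assumption) ih₂
    all_goals exact .app ih₁ ih₂

/-- Multi-step parallel reduction. -/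
abbrev PRed : Tm → Tm → Prop := Relation.ReflTransGen PStep

theorem PRed.lred {m m' : Tm} (h : PRed m m') : LRed m m' := by
  induction h with
  | refl => exact .refl
  | tail _ h ih => exact ih.trans h.lred

theorem LRed.conv {m m' : Tm} (h : LRed m m') : Conv m m' := by
  induction h with
  | refl => exact .refl _
  | tail _ h ih => exact .trans _ _ _ ih (.rel _ _ h)

theorem Conv.refl (m : Tm) : Conv m m := Relation.EqvGen.refl m

theorem Conv.symm {m n : Tm} (h : Conv m n) : Conv n m := Relation.EqvGen.symm _ _ h

theorem Conv.trans {m n p : Tm} (h : Conv m n) (h' : Conv n p) : Conv m p :=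
  Relation.EqvGen.trans _ _ _ h h'

/-- Lift a reduction-preserving map to conversion. -/
theorem Conv.map {f : Tm → Tm} (hf : ∀ a b, LStep a b → Conv (f a) (f b)) {m n : Tm}
    (h : Conv m n) : Conv (f m) (f n) := by
  induction h with
  | rel _ _ h => exact hf _ _ h
  | refl => exact .refl _
  | symm _ _ _ ih => exact ih.symm
  | trans _ _ _ _ _ ih₁ ih₂ => exact ih₁.trans ih₂

theorem Conv.subst {m n : Tm} (h : Conv m n) (σ : Nat → Tm) :
    Conv (TLL.subst σ m) (TLL.subst σ n) :=
  h.map fun _ _ h => .rel _ _ (h.subst σ)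

theorem Conv.rename {m n : Tm} (h : Conv m n) (ξ : Nat → Nat) :
    Conv (TLL.rename ξ m) (TLL.rename ξ n) := by
  rw [rename_eq_subst, rename_eq_subst]; exact h.subst _

theorem Conv.subst1_left {n n' : Tm} (h : LRed n n') (B : Tm) :
    Conv (TLL.subst1 n B) (TLL.subst1 n' B) := by
  induction h with
  | refl => exact .refl _
  | tail _ h ih => exact ih.trans ((PStep.refl B).subst1 h.pstep).lred.conv

theorem Conv.join {m n : Tm} (h : Conv m n) : ∃ p, PRed m p ∧ PRed n p := by
  induction h with
  | rel _ _ h => exact ⟨_, .single h.pstep, .refl⟩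
  | refl => exact ⟨_, .refl, .refl⟩
  | symm _ _ _ ih => obtain ⟨p, h₁, h₂⟩ := ih; exact ⟨p, h₂, h₁⟩
  | trans _ _ _ _ _ ih₁ ih₂ =>
    obtain ⟨p, h₁, h₂⟩ := ih₁
    obtain ⟨q, h₃, h₄⟩ := ih₂
    obtain ⟨r, h₅, h₆⟩ := Relation.church_rosser
      (fun a b c hb hc => ⟨TLL.develop a, .single hb.develop, .single hc.develop⟩) h₂ h₃
    exact ⟨r, h₁.trans h₅, h₄.trans h₆⟩

theorem PRed.pi0 {t A B C} (h : PRed (.pi0 t A B) C) :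
    ∃ A' B', C = .pi0 t A' B' ∧ PRed A A' ∧ PRed B B' := by
  induction h with
  | refl => exact ⟨_, _, rfl, .refl, .refl⟩
  | tail _ h ih =>
    obtain ⟨A', B', rfl, hA, hB⟩ := ih
    cases h with
    | pi0 h₁ h₂ => exact ⟨_, _, rfl, hA.tail h₁, hB.tail h₂⟩

theorem PRed.pi1 {t A B C} (h : PRed (.pi1 t A B) C) :
    ∃ A' B', C = .pi1 t A' B' ∧ PRed A A' ∧ PRed B B' := by
  induction h with
  | refl => exact ⟨_, _, rfl, .refl, .refl⟩
  | tail _ h ih =>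
    obtain ⟨A', B', rfl, hA, hB⟩ := ih
    cases h with
    | pi1 h₁ h₂ => exact ⟨_, _, rfl, hA.tail h₁, hB.tail h₂⟩

theorem PRed.srt {s C} (h : PRed (.srt s) C) : C = .srt s := by
  induction h with
  | refl => rfl
  | tail _ h ih => subst ih; cases h; rfl

theorem PRed.conv {m n : Tm} (h : PRed m n) : Conv m n := (PRed.lred h).conv

theorem Conv.pi0_inj {t t' A A' B B'} (h : Conv (.pi0 t A B) (.pi0 t' A' B')) :
    t = t' ∧ Conv A A' ∧ Conv B B' := by
  obtain ⟨p, h₁, h₂⟩ := h.join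
  obtain ⟨_, _, rfl, hA, hB⟩ := PRed.pi0 h₁
  obtain ⟨_, _, he, hA', hB'⟩ := PRed.pi0 h₂
  cases he
  exact ⟨rfl, (PRed.conv hA).trans (PRed.conv hA').symm,
    (PRed.conv hB).trans (PRed.conv hB').symm⟩

theorem Conv.pi1_inj {t t' A A' B B'} (h : Conv (.pi1 t A B) (.pi1 t' A' B')) :
    t = t' ∧ Conv A A' ∧ Conv B B' := by
  obtain ⟨p, h₁, h₂⟩ := h.join
  obtain ⟨_, _, rfl, hA, hB⟩ := PRed.pi1 h₁
  obtain ⟨_, _, he, hA', hB'⟩ := PRed.pi1 h₂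
  cases he
  exact ⟨rfl, (PRed.conv hA).trans (PRed.conv hA').symm,
    (PRed.conv hB).trans (PRed.conv hB').symm⟩

theorem Conv.not_pi0_pi1 {t t' A A' B B'} : ¬ Conv (.pi0 t A B) (.pi1 t' A' B') := by
  intro h
  obtain ⟨p, h₁, h₂⟩ := h.join
  obtain ⟨_, _, rfl, -, -⟩ := PRed.pi0 h₁
  obtain ⟨_, _, he, -, -⟩ := PRed.pi1 h₂
  cases he

theorem Conv.srt_inj {s t} (h : Conv (.srt s) (.srt t)) : s = t := by
  obtain ⟨p, h₁, h₂⟩ := h.join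
  cases PRed.srt h₁; cases PRed.srt h₂; rfl

/-! ### Metatheory of logical typing -/

/-- `P` holds of the typing of every entry of a context. -/
def CtxAll (P : (Γ : Ctx) → (m A : Tm) → LTyped Γ m A → Prop) : Ctx → Prop
  | [] => True
  | A :: Γ => (∃ s, ∃ h : LTyped Γ A (.srt s), P Γ A (.srt s) h) ∧ CtxAll P Γ

/-- Induction on logical typing that also provides the induction hypothesis for the domain
of an abstraction. -/
@[elab_as_elim]
theorem LTyped.strong_induction {P : (Γ : Ctx) → (m A : Tm) → LTyped Γ m A → Prop}
    (srt : ∀ {Γ} (s : Srt) (h : LWf Γ), P Γ (.srt s) (.srt .U) (.srt s h))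
    (var : ∀ {Γ x A} (h : LWf Γ) (hx : Has Γ x A), P Γ (.var x) A (.var h hx))
    (pi0 : ∀ {Γ A B s r} (t : Srt) (hA : LTyped Γ A (.srt s))
      (hB : LTyped (A :: Γ) B (.srt r)),
      P Γ A (.srt s) hA → P (A :: Γ) B (.srt r) hB → P Γ (.pi0 t A B) (.srt t) (.pi0 t hA hB))
    (pi1 : ∀ {Γ A B s r} (t : Srt) (hA : LTyped Γ A (.srt s))
      (hB : LTyped (A :: Γ) B (.srt r)),
      P Γ A (.srt s) hA → P (A :: Γ) B (.srt r) hB → P Γ (.pi1 t A B) (.srt t) (.pi1 t hA hB))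
    (lam0 : ∀ {Γ A B m s} (t : Srt) (hA : LTyped Γ A (.srt s)) (hm : LTyped (A :: Γ) m B),
      P Γ A (.srt s) hA → P (A :: Γ) m B hm → P Γ (.lam0 t A m) (.pi0 t A B) (.lam0 t hm))
    (lam1 : ∀ {Γ A B m s} (t : Srt) (hA : LTyped Γ A (.srt s)) (hm : LTyped (A :: Γ) m B),
      P Γ A (.srt s) hA → P (A :: Γ) m B hm → P Γ (.lam1 t A m) (.pi1 t A B) (.lam1 t hm))
    (app0 : ∀ {Γ m n A B t} (hm : LTyped Γ m (.pi0 t A B)) (hn : LTyped Γ n A),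
      P Γ m (.pi0 t A B) hm → P Γ n A hn → P Γ (.app m n) (subst1 n B) (.app0 hm hn))
    (app1 : ∀ {Γ m n A B t} (hm : LTyped Γ m (.pi1 t A B)) (hn : LTyped Γ n A),
      P Γ m (.pi1 t A B) hm → P Γ n A hn → P Γ (.app m n) (subst1 n B) (.app1 hm hn))
    (conv : ∀ {Γ m A B s} (hm : LTyped Γ m A) (hB : LTyped Γ B (.srt s)) (hc : Conv A B),
      P Γ m A hm → P Γ B (.srt s) hB → P Γ m B (.conv hm hB hc))
    {Γ : Ctx} {m A : Tm} (h : LTyped Γ m A) : P Γ m A h := by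
  refine (LTyped.rec (motive_1 := fun Γ _ => CtxAll P Γ)
    (motive_2 := fun Γ m A h => P Γ m A h ∧ CtxAll P Γ)
    ?_ ?_ ?_ ?_ ?_ ?_ ?_ ?_ ?_ ?_ ?_ h).1
  · trivial
  · intro _ _ _ _ h₂ ih₁ ih₂; exact ⟨⟨_, h₂, ih₂.1⟩, ih₁⟩
  · intro _ s h ih; exact ⟨srt s h, ih⟩
  · intro _ _ _ h₁ h₂ ih; exact ⟨var h₁ h₂, ih⟩
  · intro _ _ _ _ _ t h₁ h₂ ih₁ ih₂; exact ⟨pi0 t h₁ h₂ ih₁.1 ih₂.1, ih₁.2⟩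
  · intro _ _ _ _ _ t h₁ h₂ ih₁ ih₂; exact ⟨pi1 t h₁ h₂ ih₁.1 ih₂.1, ih₁.2⟩
  · intro _ _ _ _ t h ⟨ih, ⟨s, hA, ihA⟩, ihΓ⟩; exact ⟨lam0 t hA h ihA ih, ihΓ⟩
  · intro _ _ _ _ t h ⟨ih, ⟨s, hA, ihA⟩, ihΓ⟩; exact ⟨lam1 t hA h ihA ih, ihΓ⟩
  · intro _ _ _ _ _ _ h₁ h₂ ih₁ ih₂; exact ⟨app0 h₁ h₂ ih₁.1 ih₂.1, ih₁.2⟩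
  · intro _ _ _ _ _ _ h₁ h₂ ih₁ ih₂; exact ⟨app1 h₁ h₂ ih₁.1 ih₂.1, ih₁.2⟩
  · intro _ _ _ _ _ h₁ h₂ hc ih₁ ih₂; exact ⟨conv h₁ h₂ hc ih₁.1 ih₂.1, ih₁.2⟩

theorem LWf.tail {Γ A} (h : LWf (A :: Γ)) : LWf Γ := by
  cases h; assumption

theorem LWf.head {Γ A} (h : LWf (A :: Γ)) : ∃ s, LTyped Γ A (.srt s) := by
  cases h; exact ⟨_, by assumption⟩

theorem LTyped.wf {Γ m A} (h : LTyped Γ m A) : LWf Γ := by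
  induction h using LTyped.strong_induction with
  | srt _ h => exact h
  | var h _ => exact h
  | pi0 _ _ _ ih _ | pi1 _ _ _ ih _ | lam0 _ _ _ ih _ | lam1 _ _ _ ih _ => exact ih
  | app0 _ _ ih _ | app1 _ _ ih _ | conv _ _ _ ih _ => exact ih

theorem LTyped.rename {Γ m A} (h : LTyped Γ m A) :
    ∀ {Γ' ξ}, LWf Γ' → (∀ x B, Has Γ x B → Has Γ' (ξ x) (TLL.rename ξ B)) →
      LTyped Γ' (TLL.rename ξ m) (TLL.rename ξ A) := by
  have hup : ∀ {Γ Γ' A ξ}, (∀ x B, Has Γ x B → Has Γ' (ξ x) (TLL.rename ξ B)) →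
      ∀ x B, Has (A :: Γ) x B →
        Has (TLL.rename ξ A :: Γ') (upr ξ x) (TLL.rename (upr ξ) B) := by
    intro Γ Γ' A ξ hξ x B hx
    cases hx with
    | zero => rw [rename_upr_rename_succ]; exact .zero
    | succ hx => rw [rename_upr_rename_succ]; exact .succ (hξ _ _ hx)
  induction h using LTyped.strong_induction with
  | srt s _ => intro Γ' ξ hw _; exact .srt s hw
  | var _ hx => intro Γ' ξ hw hξ; exact .var hw (hξ _ _ hx)
  | pi0 t _ _ ih₁ ih₂ =>
    intro Γ' ξ hw hξ; exact .pi0 t (ih₁ hw hξ) (ih₂ (.cons hw (ih₁ hw hξ)) (hup hξ))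
  | pi1 t _ _ ih₁ ih₂ =>
    intro Γ' ξ hw hξ; exact .pi1 t (ih₁ hw hξ) (ih₂ (.cons hw (ih₁ hw hξ)) (hup hξ))
  | lam0 t _ _ ih₁ ih₂ =>
    intro Γ' ξ hw hξ; exact .lam0 t (ih₂ (.cons hw (ih₁ hw hξ)) (hup hξ))
  | lam1 t _ _ ih₁ ih₂ =>
    intro Γ' ξ hw hξ; exact .lam1 t (ih₂ (.cons hw (ih₁ hw hξ)) (hup hξ))
  | app0 _ _ ih₁ ih₂ =>
    intro Γ' ξ hw hξ; rw [rename_subst1]; exact .app0 (ih₁ hw hξ) (ih₂ hw hξ)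
  | app1 _ _ ih₁ ih₂ =>
    intro Γ' ξ hw hξ; rw [rename_subst1]; exact .app1 (ih₁ hw hξ) (ih₂ hw hξ)
  | conv _ _ hc ih₁ ih₂ =>
    intro Γ' ξ hw hξ; exact .conv (ih₁ hw hξ) (ih₂ hw hξ) (hc.rename ξ)

theorem LTyped.weaken {Γ m A B} (h : LTyped Γ m A) (hw : LWf (B :: Γ)) :
    LTyped (B :: Γ) (TLL.rename Nat.succ m) (TLL.rename Nat.succ A) :=
  h.rename hw fun _ _ hx => .succ hx

/-- Well-typed substitutions between logical contexts. -/
def LSub (Γ' : Ctx) (σ : Nat → Tm) (Γ : Ctx) : Prop :=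
  ∀ x B, Has Γ x B → LTyped Γ' (σ x) (subst σ B)

theorem LSub.up {Γ' σ Γ A} (h : LSub Γ' σ Γ) (hw : LWf (TLL.subst σ A :: Γ')) :
    LSub (TLL.subst σ A :: Γ') (TLL.up σ) (A :: Γ) := by
  intro x B hx
  cases hx with
  | zero => rw [subst_up_rename_succ]; exact .var hw .zero
  | succ hx => rw [subst_up_rename_succ]; exact (h _ _ hx).weaken hw

theorem LTyped.subst {Γ m A} (h : LTyped Γ m A) :
    ∀ {Γ' σ}, LWf Γ' → LSub Γ' σ Γ → LTyped Γ' (TLL.subst σ m) (TLL.subst σ A) := by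
  induction h using LTyped.strong_induction with
  | srt s _ => intro Γ' σ hw _; exact .srt s hw
  | var _ hx => intro Γ' σ _ hσ; exact hσ _ _ hx
  | pi0 t _ _ ih₁ ih₂ =>
    intro Γ' σ hw hσ
    have hA := LWf.cons hw (ih₁ hw hσ)
    exact .pi0 t (ih₁ hw hσ) (ih₂ hA (hσ.up hA))
  | pi1 t _ _ ih₁ ih₂ =>
    intro Γ' σ hw hσ
    have hA := LWf.cons hw (ih₁ hw hσ)
    exact .pi1 t (ih₁ hw hσ) (ih₂ hA (hσ.up hA))
  | lam0 t _ _ ih₁ ih₂ =>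
    intro Γ' σ hw hσ
    have hA := LWf.cons hw (ih₁ hw hσ)
    exact .lam0 t (ih₂ hA (hσ.up hA))
  | lam1 t _ _ ih₁ ih₂ =>
    intro Γ' σ hw hσ
    have hA := LWf.cons hw (ih₁ hw hσ)
    exact .lam1 t (ih₂ hA (hσ.up hA))
  | app0 _ _ ih₁ ih₂ =>
    intro Γ' σ hw hσ; rw [subst_subst1]; exact .app0 (ih₁ hw hσ) (ih₂ hw hσ)
  | app1 _ _ ih₁ ih₂ =>
    intro Γ' σ hw hσ; rw [subst_subst1]; exact .app1 (ih₁ hw hσ) (ih₂ hw hσ)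
  | conv _ _ hc ih₁ ih₂ =>
    intro Γ' σ hw hσ; exact .conv (ih₁ hw hσ) (ih₂ hw hσ) (hc.subst σ)

theorem LTyped.subst1 {Γ A m B n} (h : LTyped (A :: Γ) m B) (hn : LTyped Γ n A) :
    LTyped Γ (TLL.subst1 n m) (TLL.subst1 n B) := by
  rw [subst1_eq, subst1_eq]
  refine h.subst hn.wf fun x C hx => ?_
  cases hx with
  | zero => rw [subst_inst_rename]; exact hn
  | succ hx => rw [subst_inst_rename]; exact .var hn.wf hx

theorem LTyped.ctx_conv {Γ A A' m B s s'} (h : LTyped (A :: Γ) m B)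
    (hA : LTyped Γ A (.srt s)) (hA' : LTyped Γ A' (.srt s')) (hc : Conv A' A) :
    LTyped (A' :: Γ) m B := by
  have hw : LWf (A' :: Γ) := .cons hA.wf hA'
  have := h.subst (σ := Tm.var) hw (fun x C hx => by
    rw [subst_var]
    cases hx with
    | zero => exact .conv (.var hw .zero) (hA.weaken hw) (hc.rename _)
    | succ hx => exact .var hw (.succ hx))
  rwa [subst_var, subst_var] at this

theorem Has.typed {Γ x A} (h : Has Γ x A) (hw : LWf Γ) : ∃ s, LTyped Γ A (.srt s) := by
  induction h with
  | zero => obtain ⟨s, hs⟩ := hw.head; exact ⟨s, hs.weaken hw⟩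
  | succ _ ih => obtain ⟨s, hs⟩ := ih hw.tail; exact ⟨s, hs.weaken hw⟩

theorem LTyped.pi0_inv {Γ t A B C} (h : LTyped Γ (.pi0 t A B) C) :
    (∃ s, LTyped Γ A (.srt s)) ∧ (∃ r, LTyped (A :: Γ) B (.srt r)) ∧ Conv C (.srt t) := by
  generalize hm : Tm.pi0 t A B = m at h
  induction h using LTyped.strong_induction with
  | pi0 _ hA hB _ _ => cases hm; exact ⟨⟨_, hA⟩, ⟨_, hB⟩, .refl _⟩
  | conv _ _ hc ih _ => obtain ⟨hA, hB, h⟩ := ih hm; exact ⟨hA, hB, hc.symm.trans h⟩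
  | _ => cases hm

theorem LTyped.pi1_inv {Γ t A B C} (h : LTyped Γ (.pi1 t A B) C) :
    (∃ s, LTyped Γ A (.srt s)) ∧ (∃ r, LTyped (A :: Γ) B (.srt r)) ∧ Conv C (.srt t) := by
  generalize hm : Tm.pi1 t A B = m at h
  induction h using LTyped.strong_induction with
  | pi1 _ hA hB _ _ => cases hm; exact ⟨⟨_, hA⟩, ⟨_, hB⟩, .refl _⟩
  | conv _ _ hc ih _ => obtain ⟨hA, hB, h⟩ := ih hm; exact ⟨hA, hB, hc.symm.trans h⟩
  | _ => cases hm

theorem LTyped.lam0_inv {Γ t A m C} (h : LTyped Γ (.lam0 t A m) C) :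
    ∃ B, LTyped (A :: Γ) m B ∧ Conv C (.pi0 t A B) := by
  generalize hm : Tm.lam0 t A m = n at h
  induction h using LTyped.strong_induction with
  | lam0 _ _ hB _ _ => cases hm; exact ⟨_, hB, .refl _⟩
  | conv _ _ hc ih _ => obtain ⟨B, hB, h⟩ := ih hm; exact ⟨B, hB, hc.symm.trans h⟩
  | _ => cases hm

theorem LTyped.lam1_inv {Γ t A m C} (h : LTyped Γ (.lam1 t A m) C) :
    ∃ B, LTyped (A :: Γ) m B ∧ Conv C (.pi1 t A B) := by
  generalize hm : Tm.lam1 t A m = n at h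
  induction h using LTyped.strong_induction with
  | lam1 _ _ hB _ _ => cases hm; exact ⟨_, hB, .refl _⟩
  | conv _ _ hc ih _ => obtain ⟨B, hB, h⟩ := ih hm; exact ⟨B, hB, hc.symm.trans h⟩
  | _ => cases hm

theorem LTyped.validity {Γ m A} (h : LTyped Γ m A) : ∃ s, LTyped Γ A (.srt s) := by
  induction h using LTyped.strong_induction with
  | srt _ hw => exact ⟨_, .srt _ hw⟩
  | var hw hx => exact hx.typed hw
  | pi0 t hA _ _ _ | pi1 t hA _ _ _ => exact ⟨_, .srt t hA.wf⟩
  | lam0 t hA _ _ ih => obtain ⟨_, hB⟩ := ih; exact ⟨_, .pi0 t hA hB⟩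
  | lam1 t hA _ _ ih => obtain ⟨_, hB⟩ := ih; exact ⟨_, .pi1 t hA hB⟩
  | app0 _ hn ih _ =>
    obtain ⟨_, hp⟩ := ih
    obtain ⟨-, ⟨r, hB⟩, -⟩ := hp.pi0_inv
    exact ⟨r, hB.subst1 hn⟩
  | app1 _ hn ih _ =>
    obtain ⟨_, hp⟩ := ih
    obtain ⟨-, ⟨r, hB⟩, -⟩ := hp.pi1_inv
    exact ⟨r, hB.subst1 hn⟩
  | conv _ hB _ _ _ => exact ⟨_, hB⟩

/-- Contraction of a relevant or irrelevant redex preserves logical types. -/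
theorem LTyped.beta {Γ n A B A' B' m} (hm : LTyped (A' :: Γ) m B') (hn : LTyped Γ n A)
    (hA : Conv A A') (hB : Conv B B') {r} (hBr : LTyped (A :: Γ) B (.srt r)) :
    LTyped Γ (TLL.subst1 n m) (TLL.subst1 n B) := by
  obtain ⟨_, hA'⟩ := hm.wf.head
  have hs := hBr.subst1 hn
  refine .conv (hm.subst1 (.conv hn hA' hA)) hs ?_
  rw [subst1_eq, subst1_eq]
  exact hB.symm.subst _

theorem LTyped.step {Γ m A} (h : LTyped Γ m A) : ∀ {m'}, LStep m m' → LTyped Γ m' A := by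
  induction h using LTyped.strong_induction with
  | srt | var => intro _ h; cases h
  | pi0 t hA hB ihA ihB =>
    intro _ h
    cases h with
    | pi0A h => exact .pi0 t (ihA h) (hB.ctx_conv hA (ihA h) (.symm (.rel _ _ h)))
    | pi0B h => exact .pi0 t hA (ihB h)
  | pi1 t hA hB ihA ihB =>
    intro _ h
    cases h with
    | pi1A h => exact .pi1 t (ihA h) (hB.ctx_conv hA (ihA h) (.symm (.rel _ _ h)))
    | pi1B h => exact .pi1 t hA (ihB h)
  | lam0 t hA hm ihA ihm =>
    intro _ h
    cases h with
    | lam0A h =>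
      obtain ⟨_, hB⟩ := hm.validity
      exact .conv (.lam0 t (hm.ctx_conv hA (ihA h) (.symm (.rel _ _ h)))) (.pi0 t hA hB)
        (.symm (.rel _ _ (.pi0A h)))
    | lam0M h => exact .lam0 t (ihm h)
  | lam1 t hA hm ihA ihm =>
    intro _ h
    cases h with
    | lam1A h =>
      obtain ⟨_, hB⟩ := hm.validity
      exact .conv (.lam1 t (hm.ctx_conv hA (ihA h) (.symm (.rel _ _ h)))) (.pi1 t hA hB)
        (.symm (.rel _ _ (.pi1A h)))
    | lam1M h => exact .lam1 t (ihm h)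
  | app0 hm hn ihm ihn =>
    intro _ h
    obtain ⟨_, hp⟩ := hm.validity
    obtain ⟨-, ⟨r, hB⟩, -⟩ := hp.pi0_inv
    cases h with
    | appL h => exact .app0 (ihm h) hn
    | appR h =>
      exact .conv (.app0 hm (ihn h)) (hB.subst1 hn) (Conv.subst1_left (.single h) _).symm
    | beta0 =>
      obtain ⟨_, hm', hc⟩ := hm.lam0_inv
      obtain ⟨-, hA, hB'⟩ := hc.pi0_inj
      exact hm'.beta hn hA hB' hB
    | beta1 =>
      obtain ⟨_, _, hc⟩ := hm.lam1_inv
      exact absurd hc Conv.not_pi0_pi1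
  | app1 hm hn ihm ihn =>
    intro _ h
    obtain ⟨_, hp⟩ := hm.validity
    obtain ⟨-, ⟨r, hB⟩, -⟩ := hp.pi1_inv
    cases h with
    | appL h => exact .app1 (ihm h) hn
    | appR h =>
      exact .conv (.app1 hm (ihn h)) (hB.subst1 hn) (Conv.subst1_left (.single h) _).symm
    | beta1 =>
      obtain ⟨_, hm', hc⟩ := hm.lam1_inv
      obtain ⟨-, hA, hB'⟩ := hc.pi1_inj
      exact hm'.beta hn hA hB' hB
    | beta0 =>
      obtain ⟨_, _, hc⟩ := hm.lam0_inv
      exact absurd hc.symm Conv.not_pi0_pi1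
  | conv _ hB hc ih _ => intro _ h; exact .conv (ih h) hB hc

theorem LTyped.red {Γ m m' A} (h : LTyped Γ m A) (hr : LRed m m') : LTyped Γ m' A := by
  induction hr with
  | refl => exact h
  | tail _ hs ih => exact ih.step hs

theorem LTyped.srt_eq_of_conv_pi0 {Γ C s t A B} (h : LTyped Γ C (.srt s))
    (hc : Conv (.pi0 t A B) C) : t = s := by
  obtain ⟨p, h₁, h₂⟩ := hc.join
  obtain ⟨_, _, rfl, -, -⟩ := PRed.pi0 h₁
  exact ((h.red (PRed.lred h₂)).pi0_inv.2.2.srt_inj).symm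

theorem LTyped.srt_eq_of_conv_pi1 {Γ C s t A B} (h : LTyped Γ C (.srt s))
    (hc : Conv (.pi1 t A B) C) : t = s := by
  obtain ⟨p, h₁, h₂⟩ := hc.join
  obtain ⟨_, _, rfl, -, -⟩ := PRed.pi1 h₁
  exact ((h.red (PRed.lred h₂)).pi1_inv.2.2.srt_inj).symm

/-! ### Closed terms -/

theorem ClosedUnder.mono {m : Tm} : ∀ {k k'}, ClosedUnder k m → k ≤ k' → ClosedUnder k' m := by
  induction m <;> intro k k' h hk <;> simp only [ClosedUnder] at h ⊢
  case var => omega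
  case app ih₁ ih₂ => exact ⟨ih₁ h.1 hk, ih₂ h.2 hk⟩
  all_goals
    rename_i ih₁ ih₂
    exact ⟨ih₁ h.1 hk, ih₂ h.2 (by omega)⟩

theorem ClosedUnder.subst_eq {m : Tm} : ∀ {k σ}, ClosedUnder k m → (∀ x < k, σ x = .var x) →
    subst σ m = m := by
  have hup : ∀ {k σ}, (∀ x < k, σ x = .var x) → ∀ x < k + 1, up σ x = .var x := by
    intro k σ h x hx
    cases x with
    | zero => rfl
    | succ x => simp [up, h x (by omega), rename]
  induction m <;> intro k σ h hσ <;> simp only [ClosedUnder] at h <;>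
    simp only [TLL.subst]
  case var => exact hσ _ h
  case app ih₁ ih₂ => rw [ih₁ h.1 hσ, ih₂ h.2 hσ]
  all_goals
    rename_i ih₁ ih₂
    rw [ih₁ h.1 hσ, ih₂ h.2 (hup hσ)]

theorem ClosedUnder.subst_closed {m : Tm} (h : ClosedUnder 0 m) (σ : Nat → Tm) :
    subst σ m = m :=
  h.subst_eq fun x hx => absurd hx (Nat.not_lt_zero x)

theorem ClosedUnder.rename_closed {m : Tm} (h : ClosedUnder 0 m) (ξ : Nat → Nat) :
    rename ξ m = m := by
  rw [rename_eq_subst]; exact h.subst_closed _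

theorem Has.lt_length {Γ x A} (h : Has Γ x A) : x < Γ.length := by
  induction h <;> simp_all

theorem LTyped.closed {Γ m A} (h : LTyped Γ m A) : ClosedUnder Γ.length m := by
  induction h using LTyped.strong_induction with
  | srt => trivial
  | var _ hx => exact hx.lt_length
  | pi0 _ _ _ ih₁ ih₂ | pi1 _ _ _ ih₁ ih₂ | lam0 _ _ _ ih₁ ih₂ | lam1 _ _ _ ih₁ ih₂ =>
    exact ⟨ih₁, ih₂⟩
  | app0 _ _ ih₁ ih₂ | app1 _ _ ih₁ ih₂ => exact ⟨ih₁, ih₂⟩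
  | conv _ _ _ ih _ => exact ih

/-! ### Program contexts -/

theorem Restr.linear : ∀ Δ : PCtx, Restr Δ .L
  | [] => .nil
  | none :: Δ => .skip (linear Δ)
  | some (_, _) :: Δ => .l (linear Δ)

theorem Restr.append {Δ t Φ} (h : Restr Δ t) (hΦ : Restr Φ .U) : Restr (Δ ++ Φ) t := by
  induction h with
  | @nil s => cases s with
    | U => exact hΦ
    | L => exact .linear _
  | skip _ ih => exact .skip ih
  | u _ ih => exact .u ih
  | l _ ih => exact .l ih

theorem Merge.self {Φ} (h : Restr Φ .U) : Merge Φ Φ Φ := by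
  generalize ht : Srt.U = t at h
  induction h with
  | nil => exact .nil
  | skip _ ih => exact .skip (ih ht)
  | u _ ih => exact .contra (ih ht)
  | l h ih =>
    rename_i s _ _
    cases ht

theorem Merge.append {Δ₁ Δ₂ Δ Φ} (h : Merge Δ₁ Δ₂ Δ) (hΦ : Restr Φ .U) :
    Merge (Δ₁ ++ Φ) (Δ₂ ++ Φ) (Δ ++ Φ) := by
  induction h with
  | nil => exact .self hΦ
  | contra _ ih => exact .contra ih
  | left _ ih => exact .left ih
  | right _ ih => exact .right ih
  | skip _ ih => exact .skip ih

theorem PHas.append {Δ x s A Φ} (h : PHas Δ x s A) (hΦ : Restr Φ .U) :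
    PHas (Δ ++ Φ) x s A := by
  induction h with
  | zero h => exact .zero (h.append hΦ)
  | succN _ ih => exact .succN ih
  | succU _ ih => exact .succU ih

theorem PWf.lwf {Γ Δ} (h : PWf Γ Δ) : LWf Γ := by
  induction h with
  | nil => exact .nil
  | cons _ hA ih | consN _ hA ih => exact .cons ih hA

theorem PHas.has {Γ Δ x s A} (h : PHas Δ x s A) (hw : PWf Γ Δ) : Has Γ x A := by
  induction h generalizing Γ with
  | zero => cases hw; exact .zero
  | succN _ ih => cases hw; exact .succ (ih (by assumption))
  | succU _ ih => cases hw; exact .succ (ih (by assumption))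

theorem Merge.pwf {Γ Δ₁ Δ₂ Δ} (h : Merge Δ₁ Δ₂ Δ) (h₁ : PWf Γ Δ₁) (h₂ : PWf Γ Δ₂) :
    PWf Γ Δ := by
  induction h generalizing Γ with
  | nil => exact h₁
  | contra _ ih =>
    cases h₁; cases h₂; exact .cons (ih (by assumption) (by assumption)) (by assumption)
  | left _ ih =>
    cases h₁; cases h₂; exact .cons (ih (by assumption) (by assumption)) (by assumption)
  | right _ ih =>
    cases h₁; cases h₂; exact .cons (ih (by assumption) (by assumption)) (by assumption)
  | skip _ ih =>
    cases h₁; cases h₂; exact .consN (ih (by assumption) (by assumption)) (by assumption)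

theorem LTyped.append {Γ Ξ m A} (h : LTyped Γ m A) (hw : LWf (Γ ++ Ξ)) :
    LTyped (Γ ++ Ξ) m A := by
  have := h.rename (ξ := id) hw fun x B hx => by
    rw [rename_id]
    clear hw h
    induction hx with
    | zero => exact .zero
    | succ _ ih => exact .succ ih
  rwa [rename_id, rename_id] at this

theorem PWf.append {Γ Δ Ξ Φ} (h : PWf Γ Δ) (hΞ : PWf Ξ Φ) : PWf (Γ ++ Ξ) (Δ ++ Φ) := by
  induction h with
  | nil => exact hΞ
  | cons _ hA ih => exact .cons ih (hA.append ih.lwf)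
  | consN _ hA ih => exact .consN ih (hA.append ih.lwf)

/-! ### Metatheory of erasure -/

theorem Erase.pwf {Γ Δ m m' A} (h : Erase Γ Δ m m' A) : PWf Γ Δ := by
  induction h with
  | var hw _ => exact hw
  | lam0 _ _ _ ih | lam1 _ _ _ ih => cases ih; assumption
  | app0 _ _ ih => exact ih
  | app1 _ _ hm ih₁ ih₂ => exact hm.pwf ih₁ ih₂
  | conv _ _ _ ih => exact ih

theorem Erase.ltyped {Γ Δ m m' A} (h : Erase Γ Δ m m' A) : LTyped Γ m A := by
  induction h with
  | var hw hx => exact .var hw.lwf (hx.has hw)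
  | lam0 t _ _ ih => exact .lam0 t ih
  | lam1 t _ _ ih => exact .lam1 t ih
  | app0 _ hn ih => exact .app0 ih hn
  | app1 _ _ _ ih₁ ih₂ => exact .app1 ih₁ ih₂
  | conv _ hB hc ih => exact .conv ih hB hc

theorem Erase.closed {Γ Δ m m' A} (h : Erase Γ Δ m m' A) : ClosedUnder Γ.length m' := by
  induction h with
  | var hw hx => exact (hx.has hw).lt_length
  | lam0 _ _ _ ih | lam1 _ _ _ ih => exact ⟨trivial, ih⟩
  | app0 _ _ ih => exact ⟨ih, trivial⟩
  | app1 _ _ _ ih₁ ih₂ => exact ⟨ih₁, ih₂⟩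
  | conv _ _ _ ih => exact ih

theorem Erase.append {Γ Δ m m' A Ξ Φ} (h : Erase Γ Δ m m' A) (hΞ : PWf Ξ Φ)
    (hΦ : Restr Φ .U) : Erase (Γ ++ Ξ) (Δ ++ Φ) m m' A := by
  induction h with
  | var hw hx => exact .var (hw.append hΞ) (hx.append hΦ)
  | lam0 t _ hr ih => exact .lam0 t ih (hr.append hΦ)
  | lam1 t _ hr ih => exact .lam1 t ih (hr.append hΦ)
  | app0 hm hn ih => exact .app0 ih (hn.append (hm.pwf.append hΞ).lwf)
  | app1 _ _ hm ih₁ ih₂ => exact .app1 ih₁ ih₂ (hm.append hΦ)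
  | conv hm hB hc ih => exact .conv ih (hB.append (hm.pwf.append hΞ).lwf) hc

/-- Substitution of `n` for the variable `k`. -/
def instAt (n : Tm) : Nat → Nat → Tm
  | 0 => inst n
  | k + 1 => up (instAt n k)

theorem instAt_self {n : Tm} (h : ClosedUnder 0 n) : ∀ k, instAt n k k = n
  | 0 => rfl
  | k + 1 => by simp only [instAt, up, instAt_self h k, h.rename_closed]

/-- `CtxInst n C k Γ Δ e Γ' Δ'`: the contexts `Γ'` and `Δ'` arise from `Γ` and `Δ` by
substituting `n` for their outermost variable, which has index `k`, type `C`
and program entry `e`. -/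
inductive CtxInst (n C : Tm) : Nat → Ctx → PCtx → Entry → Ctx → PCtx → Prop
  | zero (e : Entry) : CtxInst n C 0 [C] [e] e [] []
  | cons {k Γ Δ e Γ' Δ'} (s : Srt) (A : Tm) : CtxInst n C k Γ Δ e Γ' Δ' →
      CtxInst n C (k + 1) (A :: Γ) (some (s, A) :: Δ) e
        (subst (instAt n k) A :: Γ') (some (s, subst (instAt n k) A) :: Δ')
  | consN {k Γ Δ e Γ' Δ'} (A : Tm) : CtxInst n C k Γ Δ e Γ' Δ' →
      CtxInst n C (k + 1) (A :: Γ) ((none : Entry) :: Δ) e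
        (subst (instAt n k) A :: Γ') ((none : Entry) :: Δ')

theorem CtxInst.lsub {n C k Γ Δ e Γ' Δ'} (h : CtxInst n C k Γ Δ e Γ' Δ')
    (hn : LTyped [] n C) (hw : LWf Γ) : LWf Γ' ∧ LSub Γ' (instAt n k) Γ := by
  induction h with
  | zero =>
    refine ⟨.nil, fun x B hx => ?_⟩
    cases hx with
    | zero => rw [instAt, subst_inst_rename]; exact hn
    | succ hx => cases hx
  | cons s A _ ih | consN A _ ih =>
    obtain ⟨hw', hs⟩ := ih hw.tail
    obtain ⟨s, hA⟩ := hw.head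
    have hw'' := LWf.cons hw' (hA.subst hw' hs)
    exact ⟨hw'', hs.up hw''⟩

theorem CtxInst.pwf {n C k Γ Δ e Γ' Δ'} (h : CtxInst n C k Γ Δ e Γ' Δ')
    (hn : LTyped [] n C) (hw : PWf Γ Δ) : PWf Γ' Δ' := by
  induction h with
  | zero => exact .nil
  | cons s A h ih =>
    cases hw with
    | cons hw hA =>
      obtain ⟨hw', hs⟩ := h.lsub hn hw.lwf
      exact .cons (ih hw) (hA.subst hw' hs)
  | consN A h ih =>
    cases hw with
    | consN hw hA =>
      obtain ⟨hw', hs⟩ := h.lsub hn hw.lwf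
      exact .consN (ih hw) (hA.subst hw' hs)

theorem CtxInst.restr {n C k Γ Δ e Γ' Δ' t} (h : CtxInst n C k Γ Δ e Γ' Δ')
    (hr : Restr Δ t) : Restr Δ' t := by
  induction h with
  | zero => exact .nil
  | cons s A _ ih =>
    cases hr with
    | u hr => exact .u (ih hr)
    | l hr => exact .l (ih hr)
  | consN A _ ih => cases hr with | skip hr => exact .skip (ih hr)

theorem CtxInst.merge {n C k Γ Δ e Γ' Δ'} (h : CtxInst n C k Γ Δ e Γ' Δ') :
    ∀ {Δ₁ Δ₂}, Merge Δ₁ Δ₂ Δ → ∃ e₁ e₂ Δ₁' Δ₂',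
      CtxInst n C k Γ Δ₁ e₁ Γ' Δ₁' ∧ CtxInst n C k Γ Δ₂ e₂ Γ' Δ₂' ∧ Merge Δ₁' Δ₂' Δ' ∧
      (e₁ = none ∨ e₁ = e) ∧ (e₂ = none ∨ e₂ = e) := by
  induction h with
  | zero e =>
    intro Δ₁ Δ₂ hm
    cases hm <;> rename_i hm <;> cases hm <;>
      exact ⟨_, _, _, _, .zero _, .zero _, .nil, by simp, by simp⟩
  | cons s A _ ih =>
    intro Δ₁ Δ₂ hm
    cases hm with
    | contra hm =>
      obtain ⟨_, _, _, _, h₁, h₂, hm', he₁, he₂⟩ := ih hm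
      exact ⟨_, _, _, _, .cons _ _ h₁, .cons _ _ h₂, .contra hm', he₁, he₂⟩
    | left hm =>
      obtain ⟨_, _, _, _, h₁, h₂, hm', he₁, he₂⟩ := ih hm
      exact ⟨_, _, _, _, .cons _ _ h₁, .consN _ h₂, .left hm', he₁, he₂⟩
    | right hm =>
      obtain ⟨_, _, _, _, h₁, h₂, hm', he₁, he₂⟩ := ih hm
      exact ⟨_, _, _, _, .consN _ h₁, .cons _ _ h₂, .right hm', he₁, he₂⟩
  | consN A _ ih =>
    intro Δ₁ Δ₂ hm
    cases hm with
    | skip hm =>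
      obtain ⟨_, _, _, _, h₁, h₂, hm', he₁, he₂⟩ := ih hm
      exact ⟨_, _, _, _, .consN _ h₁, .consN _ h₂, .skip hm', he₁, he₂⟩

theorem CtxInst.has {n C k Γ Δ e Γ' Δ' x s A} (h : CtxInst n C k Γ Δ e Γ' Δ')
    (hx : PHas Δ x s A) :
    (x = k ∧ ∃ D, e = some (s, D) ∧ Restr Δ' .U ∧
      (ClosedUnder 0 D → subst (instAt n k) A = D)) ∨
    ∃ y, (∀ q, instAt q k x = .var y) ∧ PHas Δ' y s (subst (instAt n k) A) := by
  induction h generalizing x A with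
  | zero e =>
    cases hx with
    | zero => exact .inl ⟨rfl, _, rfl, .nil, fun _ => subst_inst_rename _ _⟩
    | succN hx => cases hx
    | succU hx => cases hx
  | cons s' B h ih =>
    cases hx with
    | zero hr =>
      refine .inr ⟨0, fun _ => rfl, ?_⟩
      rw [instAt, subst_up_rename_succ]; exact .zero (h.restr hr)
    | succU hx =>
      rcases ih hx with ⟨rfl, D, he, hr, hD⟩ | ⟨y, hy, hp⟩
      · refine .inl ⟨rfl, D, he, .u hr, fun hc => ?_⟩
        rw [instAt, subst_up_rename_succ, hD hc, hc.rename_closed]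
      · refine .inr ⟨y + 1, fun q => by simp only [instAt, up, hy, rename], ?_⟩
        rw [instAt, subst_up_rename_succ]; exact .succU hp
  | consN B h ih =>
    cases hx with
    | succN hx =>
      rcases ih hx with ⟨rfl, D, he, hr, hD⟩ | ⟨y, hy, hp⟩
      · refine .inl ⟨rfl, D, he, .skip hr, fun hc => ?_⟩
        rw [instAt, subst_up_rename_succ, hD hc, hc.rename_closed]
      · refine .inr ⟨y + 1, fun q => by simp only [instAt, up, hy, rename], ?_⟩
        rw [instAt, subst_up_rename_succ]; exact .succN hp

/-- Substitution of a closed term for the outermost variable preserves erasure. If the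
variable is absent from the program context, its erased counterpart is arbitrary. -/
theorem Erase.subst {Γ Δ m m' B} (h : Erase Γ Δ m m' B) :
    ∀ {n q C k e Γ' Δ'}, CtxInst n C k Γ Δ e Γ' Δ' → LTyped [] n C → ClosedUnder 0 q →
      (e = none ∨ ∃ s, e = some (s, C) ∧ Erase [] [] n q C) →
      Erase Γ' Δ' (TLL.subst (instAt n k) m) (TLL.subst (instAt q k) m')
        (TLL.subst (instAt n k) B) := by
  induction h with
  | var hw hx =>
    intro n q C k e Γ' Δ' hi hn hq he
    have hw' := hi.pwf hn hw
    rcases hi.has hx with ⟨rfl, D, rfl, hr, hD⟩ | ⟨y, hy, hp⟩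
    · obtain he | ⟨s, he, hnq⟩ := he
      · cases he
      · cases he
        obtain ⟨_, hC⟩ := hn.validity
        simp only [TLL.subst]
        rw [hD hC.closed, instAt_self hn.closed, instAt_self hq]
        exact hnq.append hw' hr
    · simp only [TLL.subst, hy]
      exact .var hw' hp
  | lam0 t _ hr ih =>
    intro n q C k e Γ' Δ' hi hn hq he
    exact .lam0 t (ih (.consN _ hi) hn hq he) (hi.restr hr)
  | lam1 t _ hr ih =>
    intro n q C k e Γ' Δ' hi hn hq he
    exact .lam1 t (ih (.cons _ _ hi) hn hq he) (hi.restr hr)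
  | app0 hm hn' ih =>
    intro n q C k e Γ' Δ' hi hn hq he
    obtain ⟨hw', hs⟩ := hi.lsub hn hn'.wf
    rw [subst_subst1]
    exact .app0 (ih hi hn hq he) (hn'.subst hw' hs)
  | app1 _ _ hm ih₁ ih₂ =>
    intro n q C k e Γ' Δ' hi hn hq he
    obtain ⟨e₁, e₂, _, _, h₁, h₂, hm', he₁, he₂⟩ := hi.merge hm
    rw [subst_subst1]
    exact .app1 (ih₁ h₁ hn hq (he₁.elim .inl fun h => h ▸ he))
      (ih₂ h₂ hn hq (he₂.elim .inl fun h => h ▸ he)) hm'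
  | conv hm hB hc ih =>
    intro n q C k e Γ' Δ' hi hn hq he
    obtain ⟨hw', hs⟩ := hi.lsub hn hB.wf
    exact .conv (ih hi hn hq he) (hB.subst hw' hs) (hc.subst _)

theorem Erase.subst1_none {A m m' B n q} (h : Erase [A] [none] m m' B) (hn : LTyped [] n A)
    (hq : ClosedUnder 0 q) : Erase [] [] (TLL.subst1 n m) (TLL.subst1 q m') (TLL.subst1 n B) := by
  simp only [subst1_eq]
  exact h.subst (.zero _) hn hq (.inl rfl)

theorem Erase.subst1_some {A s m m' B n q} (h : Erase [A] [some (s, A)] m m' B)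
    (hn : Erase [] [] n q A) :
    Erase [] [] (TLL.subst1 n m) (TLL.subst1 q m') (TLL.subst1 n B) := by
  simp only [subst1_eq]
  exact h.subst (.zero _) hn.ltyped hn.closed (.inr ⟨s, rfl, hn⟩)

theorem Erase.lam0_inv {Γ Δ a t X m' T} (h : Erase Γ Δ a (.lam0 t X m') T) :
    ∃ A m B, a = .lam0 t A m ∧ Erase (A :: Γ) (none :: Δ) m m' B ∧ Conv (.pi0 t A B) T := by
  generalize hb : Tm.lam0 t X m' = b at h
  induction h with
  | lam0 _ hm _ _ => cases hb; exact ⟨_, _, _, rfl, hm, .refl _⟩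
  | conv _ _ hc ih =>
    obtain ⟨A, m, B, ha, hm, h⟩ := ih hb
    exact ⟨A, m, B, ha, hm, h.trans hc⟩
  | _ => cases hb

theorem Erase.lam1_inv {Γ Δ a t X m' T} (h : Erase Γ Δ a (.lam1 t X m') T) :
    ∃ A m B s, a = .lam1 t A m ∧ Erase (A :: Γ) (some (s, A) :: Δ) m m' B ∧
      Conv (.pi1 t A B) T := by
  generalize hb : Tm.lam1 t X m' = b at h
  induction h with
  | lam1 _ hm _ _ => cases hb; exact ⟨_, _, _, _, rfl, hm, .refl _⟩
  | conv _ _ hc ih =>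
    obtain ⟨A, m, B, s, ha, hm, h⟩ := ih hb
    exact ⟨A, m, B, s, ha, hm, h.trans hc⟩
  | _ => cases hb

theorem Erase.not_box {Γ Δ a T} : ¬ Erase Γ Δ a .box T := by
  intro h
  generalize hb : Tm.box = b at h
  induction h with
  | conv _ _ _ ih => exact ih hb
  | _ => cases hb

theorem Erase.app_inv {Γ Δ a f' n' T} (h : Erase Γ Δ a (.app f' n') T) :
    (∃ f n A B t, a = .app f n ∧ n' = .box ∧ Erase Γ Δ f f' (.pi0 t A B) ∧ LTyped Γ n A ∧
      Conv (subst1 n B) T) ∨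
    (∃ f n A B t Δ₁ Δ₂, a = .app f n ∧ Erase Γ Δ₁ f f' (.pi1 t A B) ∧ Erase Γ Δ₂ n n' A ∧
      Merge Δ₁ Δ₂ Δ ∧ Conv (subst1 n B) T) := by
  generalize hb : Tm.app f' n' = b at h
  induction h with
  | app0 hm hn _ => cases hb; exact .inl ⟨_, _, _, _, _, rfl, rfl, hm, hn, .refl _⟩
  | app1 h₁ h₂ hm _ _ =>
    cases hb; exact .inr ⟨_, _, _, _, _, _, _, rfl, h₁, h₂, hm, .refl _⟩
  | conv _ _ hc ih =>
    rcases ih hb with ⟨f, n, A, B, t, ha, hn', hm, hn, h⟩ |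
      ⟨f, n, A, B, t, Δ₁, Δ₂, ha, h₁, h₂, hm, h⟩
    · exact .inl ⟨f, n, A, B, t, ha, hn', hm, hn, h.trans hc⟩
    · exact .inr ⟨f, n, A, B, t, Δ₁, Δ₂, ha, h₁, h₂, hm, h.trans hc⟩
  | _ => cases hb

theorem CStep.lstep {m m' : Tm} (h : CStep m m') : LStep m m' := by
  induction h with
  | appL _ ih => exact .appL ih
  | appR _ ih => exact .appR ih
  | beta0 => exact .beta0
  | beta1 => exact .beta1

/-! ### Variable usage in erased terms -/

/-- The variable `k` does not occur. -/
def Absent : Nat → Tm → Prop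
  | k, .var x => x ≠ k
  | _, .srt _ => True
  | k, .pi0 _ A B => Absent k A ∧ Absent (k + 1) B
  | k, .pi1 _ A B => Absent k A ∧ Absent (k + 1) B
  | k, .lam0 _ A m => Absent k A ∧ Absent (k + 1) m
  | k, .lam1 _ A m => Absent k A ∧ Absent (k + 1) m
  | k, .app m n => Absent k m ∧ Absent k n
  | _, .box => True
  | _, .ptr _ => True

/-- The variable `k` occurs exactly once, and only below linear abstractions. -/
inductive Once : Nat → Tm → Prop
  | var {k} : Once k (.var k)
  | lam0 {k A m} : Once (k + 1) m → Once k (.lam0 .L A m)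
  | lam1 {k A m} : Once (k + 1) m → Once k (.lam1 .L A m)
  | appL {k m n} : Once k m → Absent k n → Once k (.app m n)
  | appR {k m n} : Absent k m → Once k n → Once k (.app m n)

theorem ClosedUnder.absent {m : Tm} : ∀ {j k}, ClosedUnder j m → j ≤ k → Absent k m := by
  induction m <;> intro j k h hk <;> simp only [ClosedUnder] at h <;> simp only [Absent]
  case var => omega
  case app ih₁ ih₂ => exact ⟨ih₁ h.1 hk, ih₂ h.2 hk⟩
  all_goals
    rename_i ih₁ ih₂
    exact ⟨ih₁ h.1 hk, ih₂ h.2 (by omega)⟩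

theorem Once.not_absent {k m} (h : Once k m) : ¬ Absent k m := by
  induction h with
  | var => exact fun h => h rfl
  | lam0 _ ih | lam1 _ ih => exact fun h => ih h.2
  | appL _ _ ih => exact fun h => ih h.1
  | appR _ _ ih => exact fun h => ih h.2

theorem PHas.ne_of_none {Δ : PCtx} {x s A} {k : Nat} (h : PHas Δ x s A)
    (hk : Δ[k]? = some none) : x ≠ k := by
  induction h generalizing k with
  | zero => rintro rfl; simp at hk
  | succN _ ih | succU _ ih =>
    rintro rfl; exact ih (by simpa using hk) rfl

theorem Restr.lookup_U {Δ : PCtx} {t s : Srt} {k : Nat} {C : Tm} (h : Restr Δ t)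
    (hk : Δ[k]? = some (some (s, C)))
    (ht : t = .U) : s = .U := by
  induction h generalizing k with
  | nil => simp at hk
  | skip _ ih =>
    cases k with
    | zero => simp at hk
    | succ k => exact ih (by simpa using hk) ht
  | u _ ih =>
    cases k with
    | zero => simp at hk; exact hk.1.symm
    | succ k => exact ih (by simpa using hk) ht
  | l => cases ht

theorem PHas.eq_of_linear {Δ : PCtx} {x s A} {k : Nat} {C : Tm} (h : PHas Δ x s A)
    (hk : Δ[k]? = some (some (.L, C))) : x = k := by
  induction h generalizing k with
  | zero hr =>
    cases k with
    | zero => rfl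
    | succ k => cases hr.lookup_U (by simpa using hk) rfl
  | succN _ ih | succU _ ih =>
    cases k with
    | zero => simp at hk
    | succ k => rw [ih (by simpa using hk)]

theorem Merge.get_none {Δ₁ Δ₂ Δ : PCtx} {k : Nat} (h : Merge Δ₁ Δ₂ Δ) (hk : Δ[k]? = some none) :
    Δ₁[k]? = some none ∧ Δ₂[k]? = some none := by
  induction h generalizing k with
  | nil => simp at hk
  | skip _ ih => cases k <;> simp_all
  | contra _ ih | left _ ih | right _ ih => cases k <;> simp_all

theorem Merge.linear {Δ₁ Δ₂ Δ : PCtx} {k : Nat} {C : Tm} (h : Merge Δ₁ Δ₂ Δ)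
    (hk : Δ[k]? = some (some (.L, C))) :
    (Δ₁[k]? = some (some (.L, C)) ∧ Δ₂[k]? = some none) ∨
    (Δ₁[k]? = some none ∧ Δ₂[k]? = some (some (.L, C))) := by
  induction h generalizing k with
  | nil => simp at hk
  | skip _ ih => cases k <;> simp_all
  | contra _ ih | left _ ih | right _ ih => cases k <;> simp_all

theorem Erase.absent {Γ Δ m m' A} (h : Erase Γ Δ m m' A) :
    ∀ {k : Nat}, Δ[k]? = some none → Absent k m' := by
  induction h with
  | var _ hx => intro k hk; exact hx.ne_of_none hk
  | lam0 _ _ _ ih | lam1 _ _ _ ih => intro k hk; exact ⟨trivial, ih (by simpa using hk)⟩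
  | app0 _ _ ih => intro k hk; exact ⟨ih hk, trivial⟩
  | app1 _ _ hm ih₁ ih₂ =>
    intro k hk; exact ⟨ih₁ (hm.get_none hk).1, ih₂ (hm.get_none hk).2⟩
  | conv _ _ _ ih => exact ih

theorem Erase.once {Γ Δ m m' A} (h : Erase Γ Δ m m' A) :
    ∀ {k : Nat} {C : Tm}, Δ[k]? = some (some (.L, C)) → Once k m' := by
  induction h with
  | var _ hx => intro k C hk; rw [hx.eq_of_linear hk]; exact .var
  | lam0 t _ hr ih =>
    intro k C hk
    cases t with
    | U => cases hr.lookup_U hk rfl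
    | L => exact .lam0 (ih (by simpa using hk))
  | lam1 t _ hr ih =>
    intro k C hk
    cases t with
    | U => cases hr.lookup_U hk rfl
    | L => exact .lam1 (ih (by simpa using hk))
  | app0 _ _ ih => intro k C hk; exact .appL (ih hk) trivial
  | app1 h₁ h₂ hm ih₁ ih₂ =>
    intro k C hk
    rcases hm.linear hk with ⟨h, h'⟩ | ⟨h, h'⟩
    · exact .appL (ih₁ h) (h₂.absent h')
    · exact .appR (h₁.absent h) (ih₂ h')
  | conv _ _ _ ih => exact ih

/-! ### Heap merges -/

theorem HMerge.symm {H₁ H₂ H} (h : HMerge H₁ H₂ H) : HMerge H₂ H₁ H := by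
  intro l
  rcases h l with h | ⟨v, h⟩ | ⟨v, h⟩ | ⟨v, h⟩ <;> simp [h]

theorem HMerge.assoc {A B AB C H} (h : HMerge A B AB) (h' : HMerge AB C H) :
    ∃ F, HMerge B C F ∧ HMerge A F H := by
  refine ⟨fun l => B l <|> C l, fun l => ?_, fun l => ?_⟩ <;>
    rcases h l with h | ⟨v, h⟩ | ⟨v, h⟩ | ⟨v, h⟩ <;>
    rcases h' l with h' | ⟨v', h'⟩ | ⟨v', h'⟩ | ⟨v', h'⟩ <;> simp_all

theorem HMerge.assoc_symm {A B C F H} (h : HMerge B C F) (h' : HMerge A F H) :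
    ∃ AB, HMerge A B AB ∧ HMerge AB C H := by
  obtain ⟨AB, h₁, h₂⟩ := h.symm.assoc h'.symm
  exact ⟨AB, h₁.symm, h₂.symm⟩

theorem HMerge.eq_left {H₁ H₂ H} (h : HMerge H₁ H₂ H) (hU : HRestr H₂ .U) : H = H₁ := by
  funext l
  rcases h l with h | ⟨v, h⟩ | ⟨v, h⟩ | ⟨v, h⟩
  · simp [h]
  · simp [h]
  · simp [h]
  · cases hU _ _ _ h.2.1

theorem HMerge.self_left {H₁ H₂ H K} (h : HMerge H₁ H₂ H) (hK : HMerge H K H)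
    (hU : HRestr K .U) : HMerge H₁ K H₁ := by
  intro l
  rcases hK l with h' | ⟨v', h'⟩ | ⟨v', h'⟩ | ⟨v', h'⟩
  · rcases h l with h | ⟨v, h⟩ | ⟨v, h⟩ | ⟨v, h⟩ <;> simp_all
  · rcases h l with h | ⟨v, h⟩ | ⟨v, h⟩ | ⟨v, h⟩ <;> simp_all
  · rcases h l with h | ⟨v, h⟩ | ⟨v, h⟩ | ⟨v, h⟩ <;> simp_all
  · cases hU _ _ _ h'.2.1

theorem HMerge.le {H₁ H₂ H} (h : HMerge H₁ H₂ H) {l x} (hl : H₁ l = some x) : H l = some x := by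
  rcases h l with h | ⟨v, h⟩ | ⟨v, h⟩ | ⟨v, h⟩ <;> simp_all

theorem HMerge.exists_unrestricted (H : Heap) : ∃ K, HMerge H K H ∧ HRestr K .U := by
  refine ⟨fun l => match H l with | some (.U, v) => some (.U, v) | _ => none,
    fun l => ?_, fun l s v h => ?_⟩
  · rcases h : H l with _ | ⟨_ | _, v⟩ <;> simp [h]
  · rcases h' : H l with _ | ⟨_ | _, v⟩ <;> simp_all

theorem Lookup.merge {H H' H₁ H₁' H₂ l v v'} (h : Lookup H l v H') (hm : HMerge H₁ H₂ H)
    (h₁ : Lookup H₁ l v' H₁') : v' = v ∧ HMerge H₁' H₂ H' := by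
  cases h with
  | u h =>
    cases h₁ with
    | u h₁ =>
      have := hm.le h₁
      simp_all
    | l h₁ =>
      have := hm.le h₁
      simp_all
  | l h =>
    cases h₁ with
    | u h₁ =>
      have := hm.le h₁
      simp_all
    | l h₁ =>
      have := hm.le h₁
      refine ⟨by simp_all, fun k => ?_⟩
      by_cases hk : k = l
      · subst hk
        rcases hm k with h' | ⟨v, h'⟩ | ⟨v, h'⟩ | ⟨v, h'⟩ <;> simp_all
      · simpa [hk] using hm k

/-! ### Heaps of closed abstractions -/

/-- Every cell holds an erased abstraction with at most one free variable, whose sort is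
that of the cell. -/
def HeapOK (H : Heap) : Prop := ∀ l s v, H l = some (s, v) →
  ∃ m, ClosedUnder 1 m ∧ (v = .lam0 s .box m ∨ v = .lam1 s .box m)

theorem WrHeap.heapOK {H} (h : WrHeap H) : HeapOK H := by
  induction h with
  | nil => intro l s v h; cases h
  | @lam0 H l t m hm _ _ ih | @lam1 H l t m hm _ _ ih =>
    intro k s v hk
    by_cases hkl : k = l
    · subst hkl; simp at hk; obtain ⟨rfl, rfl⟩ := hk; exact ⟨m, hm, by simp⟩
    · exact ih k s v (by simpa [hkl] using hk)

theorem WrHeap.remove {H} (h : WrHeap H) (l : Nat) : WrHeap (Function.update H l none) := by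
  induction h with
  | nil =>
    have : Function.update (fun _ => none : Heap) l none = fun _ => none := by simp
    rw [this]; exact .nil
  | @lam0 H k t m hm _ hk ih =>
    by_cases hkl : k = l
    · subst hkl; simpa using ih
    · rw [Function.update_comm hkl]
      exact .lam0 hm ih (by simp [hkl, hk])
  | @lam1 H k t m hm _ hk ih =>
    by_cases hkl : k = l
    · subst hkl; simpa using ih
    · rw [Function.update_comm hkl]
      exact .lam1 hm ih (by simp [hkl, hk])

theorem Lookup.wrHeap {H l v H'} (h : Lookup H l v H') (hH : WrHeap H) : WrHeap H' := by
  cases h with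
  | u => exact hH
  | l => exact hH.remove _

theorem HStep.wrHeap {H c H' c'} (h : HStep H c H' c') (hH : WrHeap H) (hc : ClosedUnder 0 c) :
    WrHeap H' := by
  induction h with
  | alloc0 hl => exact .lam0 hc.2 hH hl
  | alloc1 hl => exact .lam1 hc.2 hH hl
  | appL _ ih => exact ih hc.1
  | appR _ ih => exact ih hc.2
  | beta0 hl | beta1 hl => exact hl.wrHeap hH

theorem HeapOK.left {H₁ H₂ H} (h : HeapOK H) (hm : HMerge H₁ H₂ H) : HeapOK H₁ :=
  fun l s v hl => h l s v (hm.le hl)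

theorem HeapOK.lookup {H l v H'} (h : HeapOK H) (hl : Lookup H l v H') : HeapOK H' := by
  cases hl with
  | u => exact h
  | l hl =>
    intro k s w hk
    by_cases hkl : k = l
    · subst hkl; simp at hk
    · exact h k s w (by simpa [hkl] using hk)

theorem Lookup.closed {H l v H'} (h : Lookup H l v H') (hH : HeapOK H) : ClosedUnder 0 v := by
  have key : ∀ {s}, H l = some (s, v) → ClosedUnder 0 v := by
    intro s hl
    obtain ⟨m, hm, rfl | rfl⟩ := hH _ _ _ hl <;> exact ⟨trivial, hm⟩
  cases h with
  | u h | l h => exact key h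

theorem Resolve.closed_iff {H c b} (h : Resolve H c b) (hH : HeapOK H) :
    ∀ k, ClosedUnder k c ↔ ClosedUnder k b := by
  induction h with
  | var => exact fun _ => .rfl
  | lam0 _ _ ih | lam1 _ _ ih => exact fun k => and_congr .rfl (ih hH (k + 1))
  | app0 _ ih => exact fun k => and_congr (ih hH k) .rfl
  | app1 hm _ _ ih₁ ih₂ =>
    exact fun k => and_congr (ih₁ (hH.left hm) k) (ih₂ (hH.left hm.symm) k)
  | ptr hl _ ih =>
    exact fun k => ⟨fun _ =>
      (ih (hH.lookup hl) k).1 ((hl.closed hH).mono (Nat.zero_le k)), fun _ => trivial⟩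

theorem Resolve.ptr_closed {H l b} (h : Resolve H (.ptr l) b) (hH : HeapOK H) :
    ClosedUnder 0 b :=
  (h.closed_iff hH 0).1 trivial

theorem Resolve.not_box {H c} : ¬ Resolve H c .box := by
  intro h
  generalize hb : Tm.box = b at h
  induction h with
  | ptr _ _ ih => exact ih hb
  | _ => cases hb

theorem Resolve.ptr_lam {H l b} (h : Resolve H (.ptr l) b) (hH : HeapOK H) :
    ∃ t m, (b = .lam0 t .box m ∨ b = .lam1 t .box m) ∧ HRestr H t := by
  cases h with
  | ptr hl hr =>
    cases hl with
    | u hl =>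
      obtain ⟨m, -, rfl | rfl⟩ := hH _ _ _ hl <;> cases hr <;> rename_i hU _
      · exact ⟨_, _, .inl rfl, hU⟩
      · exact ⟨_, _, .inr rfl, hU⟩
    | l hl =>
      obtain ⟨m, -, rfl | rfl⟩ := hH _ _ _ hl <;> cases hr
      · exact ⟨_, _, .inl rfl, trivial⟩
      · exact ⟨_, _, .inr rfl, trivial⟩

/-! ### Heap extension by non-linear cells -/

/-- `H'` extends `H` with non-linear cells. -/
def Ext (H H' : Heap) : Prop :=
  (∀ l x, H l = some x → H' l = some x) ∧
  ∀ l s v, H l = none → H' l = some (s, v) → s = Srt.U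

theorem Ext.refl (H : Heap) : Ext H H := ⟨fun _ _ h => h, fun _ _ _ h h' => by simp [h] at h'⟩

theorem Ext.alloc {H : Heap} {l : Nat} (hl : H l = none) (v : Tm) :
    Ext H (Function.update H l (some (.U, v))) := by
  constructor
  · intro k x hk
    have : k ≠ l := by rintro rfl; simp [hl] at hk
    simpa [this] using hk
  · intro k s w hk hk'
    by_cases h : k = l
    · subst h; simp at hk'; exact hk'.1.symm
    · simp [h, hk] at hk'

theorem Ext.restr {H H' t} (h : Ext H H') (hr : HRestr H t) : HRestr H' t := by
  cases t with
  | U =>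
    intro l s v hl
    rcases hx : H l with _ | ⟨s', v'⟩
    · exact h.2 l s v hx hl
    · have := h.1 _ _ hx
      rw [hl] at this
      cases this
      exact hr _ _ _ hx
  | L => trivial

theorem Ext.split {H₁ H₂ H H'} (h : Ext H H') (hm : HMerge H₁ H₂ H) :
    ∃ H₁' H₂', HMerge H₁' H₂' H' ∧ Ext H₁ H₁' ∧ Ext H₂ H₂' := by
  have key : ∀ {K}, (∀ l x, K l = some x → H l = some x) →
      Ext K (fun l => if H l = none then H' l else K l) := by
    intro K hK
    constructor
    · intro l x hl
      simp [hK l x hl, hl]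
    · intro l s v hl hl'
      by_cases hH : H l = none
      · exact h.2 l s v hH (by simpa [hH] using hl')
      · simp [hH, hl] at hl'
  refine ⟨_, _, fun l => ?_, key fun _ _ => hm.le, key fun _ _ => hm.symm.le⟩
  by_cases hl : H l = none
  · rcases hx : H' l with _ | ⟨s, v⟩
    · simp [hl]
    · cases h.2 l s v hl hx
      simp [hl]
  · obtain ⟨x, hx⟩ := Option.ne_none_iff_exists'.1 hl
    simpa [hx, h.1 _ _ hx] using hm l

theorem Lookup.ext {H l v K H'} (h : Lookup H l v K) (he : Ext H H') :
    ∃ K', Lookup H' l v K' ∧ Ext K K' := by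
  cases h with
  | u h => exact ⟨_, .u (he.1 _ _ h), he⟩
  | l h =>
    refine ⟨_, .l (he.1 _ _ h), fun k x hk => ?_, fun k s w hk hk' => ?_⟩ <;>
      by_cases hkl : k = l
    · subst hkl; simp at hk
    · simpa [hkl] using he.1 k x (by simpa [hkl] using hk)
    · subst hkl; simp at hk'
    · exact he.2 k s w (by simpa [hkl] using hk) (by simpa [hkl] using hk')

theorem Resolve.ext {H c b} (h : Resolve H c b) : ∀ {H'}, Ext H H' → Resolve H' c b := by
  induction h with
  | var hr => exact fun he => .var (he.restr hr)
  | lam0 hr _ ih => exact fun he => .lam0 (he.restr hr) (ih he)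
  | lam1 hr _ ih => exact fun he => .lam1 (he.restr hr) (ih he)
  | app0 _ ih => exact fun he => .app0 (ih he)
  | app1 hm _ _ ih₁ ih₂ =>
    intro H' he
    obtain ⟨_, _, hm', h₁, h₂⟩ := he.split hm
    exact .app1 hm' (ih₁ h₁) (ih₂ h₂)
  | ptr hl _ ih =>
    intro H' he
    obtain ⟨_, hl', he'⟩ := hl.ext he
    exact .ptr hl' (ih he')

theorem Resolve.alloc {H₁ H₂ H : Heap} {l : Nat} {t : Srt} {v b : Tm} (hl : H l = none)
    (hm : HMerge H₁ H₂ H) (h : Resolve H₁ v b) :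
    ∃ H₁' H₂', HMerge H₁' H₂' (Function.update H l (some (t, v))) ∧
      Resolve H₁' (.ptr l) b ∧ Ext H₂ H₂' := by
  have hl' : H₁ l = none ∧ H₂ l = none := by
    rcases hm l with h | ⟨v, h⟩ | ⟨v, h⟩ | ⟨v, h⟩ <;> simp_all
  cases t with
  | U =>
    refine ⟨_, _, fun k => ?_, .ptr (.u (Function.update_self l (some (.U, v)) H₁))
      (h.ext (.alloc hl'.1 v)), .alloc hl'.2 v⟩
    by_cases hk : k = l
    · subst hk; simp
    · simpa [hk] using hm k
  | L =>
    refine ⟨Function.update H₁ l (some (.L, v)), H₂, fun k => ?_,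
      .ptr (.l (Function.update_self _ _ _)) ?_, .refl _⟩
    · by_cases hk : k = l
      · subst hk; simp [hl']
      · simpa [hk] using hm k
    · rwa [Function.update_idem, ← hl'.1, Function.update_eq_self]

/-! ### Substitution and pointer resolution -/

theorem instAt_of_ne {x k : Nat} (h : x ≠ k) :
    ∃ y, ∀ p, instAt p k x = .var y := by
  induction k generalizing x with
  | zero =>
    cases x with
    | zero => exact absurd rfl h
    | succ x => exact ⟨x, fun _ => rfl⟩
  | succ k ih =>
    cases x with
    | zero => exact ⟨0, fun _ => rfl⟩
    | succ x =>
      obtain ⟨y, hy⟩ := ih (x := x) (by omega)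
      exact ⟨y + 1, fun p => by simp only [instAt, up, hy, TLL.rename]⟩

theorem Resolve.subst_absent {H m m' p q} (h : Resolve H m m') (hH : HeapOK H) :
    ∀ {k}, Absent k m' → Resolve H (subst (instAt p k) m) (subst (instAt q k) m') := by
  induction h with
  | var hr =>
    intro k hk
    obtain ⟨y, hy⟩ := instAt_of_ne hk
    simp only [TLL.subst, hy]
    exact .var hr
  | lam0 hr _ ih => exact fun hk => .lam0 hr (ih hH hk.2)
  | lam1 hr _ ih => exact fun hk => .lam1 hr (ih hH hk.2)
  | app0 _ ih => exact fun hk => .app0 (ih hH hk.1)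
  | app1 hm _ _ ih₁ ih₂ =>
    exact fun hk => .app1 hm (ih₁ (hH.left hm) hk.1) (ih₂ (hH.left hm.symm) hk.2)
  | ptr hl hr =>
    intro k _
    have h := Resolve.ptr hl hr
    rw [(h.ptr_closed hH).subst_closed]
    exact h

theorem Resolve.subst_once {H₁ H₂ p q m m'} (h : Resolve H₁ m m') (hp : Resolve H₂ p q)
    (hcp : ClosedUnder 0 p) (hcq : ClosedUnder 0 q) :
    ∀ {H k}, HMerge H₁ H₂ H → HeapOK H₁ → Once k m' →
      Resolve H (subst (instAt p k) m) (subst (instAt q k) m') := by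
  induction h with
  | var hr =>
    intro H k hm _ hk
    cases hk
    simp only [TLL.subst, instAt_self hcp, instAt_self hcq]
    rw [hm.symm.eq_left hr]
    exact hp
  | lam0 _ _ ih =>
    intro H k hm hH hk
    cases hk with | lam0 hk => exact .lam0 trivial (ih hm hH hk)
  | lam1 _ _ ih =>
    intro H k hm hH hk
    cases hk with | lam1 hk => exact .lam1 trivial (ih hm hH hk)
  | app0 _ ih =>
    intro H k hm hH hk
    cases hk with
    | appL hk _ => exact .app0 (ih hm hH hk)
    | appR _ hk => cases hk
  | app1 hm' h₁ h₂ ih₁ ih₂ =>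
    intro H k hm hH hk
    cases hk with
    | appL hk hk' =>
      obtain ⟨F, hF, hF'⟩ := hm'.symm.assoc hm
      exact .app1 hF'.symm (ih₁ hF (hH.left hm') hk) (h₂.subst_absent (hH.left hm'.symm) hk')
    | appR hk hk' =>
      obtain ⟨F, hF, hF'⟩ := hm'.assoc hm
      exact .app1 hF' (h₁.subst_absent (hH.left hm') hk) (ih₂ hF (hH.left hm'.symm) hk')
  | ptr hl hr =>
    intro H k _ hH hk
    exact absurd (((Resolve.ptr hl hr).ptr_closed hH).absent (Nat.zero_le k)) hk.not_absent

theorem Resolve.subst_unrestricted {H K p q m m'} (h : Resolve H m m') (hp : Resolve K p q)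
    (hcp : ClosedUnder 0 p) (hcq : ClosedUnder 0 q) (hK : HRestr K .U) :
    ∀ {k}, HMerge H K H → HeapOK H →
      Resolve H (subst (instAt p k) m) (subst (instAt q k) m') := by
  induction h with
  | @var H x hr =>
    intro k hm hH
    by_cases hk : x = k
    · subst hk
      simp only [TLL.subst, instAt_self hcp, instAt_self hcq]
      rw [hm.symm.eq_left hr]
      exact hp
    · exact (Resolve.var hr).subst_absent hH hk
  | lam0 hr _ ih => exact fun {k} hm hH => .lam0 hr (ih (k := k + 1) hm hH)
  | lam1 hr _ ih => exact fun {k} hm hH => .lam1 hr (ih (k := k + 1) hm hH)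
  | app0 _ ih => exact fun hm hH => .app0 (ih hm hH)
  | app1 hm' _ _ ih₁ ih₂ =>
    exact fun hm hH => .app1 hm' (ih₁ (hm'.self_left hm hK) (hH.left hm'))
      (ih₂ (hm'.symm.self_left hm hK) (hH.left hm'.symm))
  | ptr hl hr =>
    intro k _ hH
    have h := Resolve.ptr hl hr
    rw [(h.ptr_closed hH).subst_closed]
    exact h

/-! ### Subject reduction -/

theorem Erase.conv_of_ltyped {a b A B m} (h : Erase [] [] a b A) (hB : LTyped [] m B)
    (hc : Conv A B) : Erase [] [] a b B :=
  let ⟨_, hs⟩ := hB.validity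
  .conv h hs hc

theorem CStep.lred {m m' : Tm} (h : Relation.ReflTransGen CStep m m') : LRed m m' := by
  induction h with
  | refl => exact .refl
  | tail _ h ih => exact ih.tail h.lstep

theorem CStep.red_appL {m m' : Tm} (n : Tm) (h : Relation.ReflTransGen CStep m m') :
    Relation.ReflTransGen CStep (.app m n) (.app m' n) := by
  induction h with
  | refl => exact .refl
  | tail _ h ih => exact ih.tail (.appL h)

theorem CStep.red_appR {n n' : Tm} (m : Tm) (h : Relation.ReflTransGen CStep n n') :
    Relation.ReflTransGen CStep (.app m n) (.app m n') := by
  induction h with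
  | refl => exact .refl
  | tail _ h ih => exact ih.tail (.appR h)

/-- Heap reduction in the part `H₁` of a heap `H = H₁ ∪̇ H₂` is simulated by program
reduction and extends the frame `H₂` by non-linear cells only. -/
theorem HStep.simulation {H c H' c'} (h : HStep H c H' c') :
    ∀ {H₁ H₂ a b A}, HMerge H₁ H₂ H → HeapOK H → Erase [] [] a b A → Resolve H₁ c b →
      ∃ a' b' H₁' H₂', HMerge H₁' H₂' H' ∧ Resolve H₁' c' b' ∧ Erase [] [] a' b' A ∧
        Relation.ReflTransGen CStep a a' ∧ Relation.ReflTransGen CStep b b' ∧ Ext H₂ H₂' := by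
  induction h with
  | alloc0 hl | alloc1 hl =>
    intro H₁ H₂ a b A hm hH he hr
    obtain ⟨_, _, hm', hr', hx⟩ := Resolve.alloc hl hm hr
    exact ⟨a, b, _, _, hm', hr', he, .refl, .refl, hx⟩
  | appL _ ih =>
    intro H₁ H₂ a b A hm hH he hr
    cases hr with
    | app0 hr =>
      obtain ⟨f, n, X, B, t, rfl, -, hf, hn, hc⟩ |
        ⟨f, n, X, B, t, Δ₁, Δ₂, rfl, hf, hn, hΔ, hc⟩ := he.app_inv
      · obtain ⟨a', b', _, _, hm', hr', he', ha, hb, hx⟩ := ih hm hH hf hr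
        exact ⟨_, _, _, _, hm', .app0 hr', (Erase.app0 he' hn).conv_of_ltyped he.ltyped hc,
          CStep.red_appL _ ha, CStep.red_appL _ hb, hx⟩
      · exact absurd hn Erase.not_box
    | app1 hm₁ hr₁ hr₂ =>
      obtain ⟨F, hF, hF'⟩ := hm₁.assoc hm
      obtain ⟨f, n, X, B, t, rfl, rfl, hf, hn, hc⟩ |
        ⟨f, n, X, B, t, Δ₁, Δ₂, rfl, hf, hn, hΔ, hc⟩ := he.app_inv
      · exact absurd hr₂ Resolve.not_box
      · cases hΔ
        obtain ⟨a', b', _, _, hm', hr', he', ha, hb, hx⟩ := ih hF' hH hf hr₁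
        obtain ⟨_, _, hs, hx₁, hx₂⟩ := hx.split hF
        obtain ⟨_, hs₁, hs₂⟩ := hs.assoc_symm hm'
        exact ⟨_, _, _, _, hs₂, .app1 hs₁ hr' (hr₂.ext hx₁),
          (Erase.app1 he' hn .nil).conv_of_ltyped he.ltyped hc,
          CStep.red_appL _ ha, CStep.red_appL _ hb, hx₂⟩
  | appR hst ih =>
    intro H₁ H₂ a b A hm hH he hr
    cases hr with
    | app0 hr => cases hst
    | app1 hm₁ hr₁ hr₂ =>
      obtain ⟨F, hF, hF'⟩ := hm₁.symm.assoc hm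
      obtain ⟨f, n, X, B, t, rfl, rfl, hf, hn, hc⟩ |
        ⟨f, n, X, B, t, Δ₁, Δ₂, rfl, hf, hn, hΔ, hc⟩ := he.app_inv
      · exact absurd hr₂ Resolve.not_box
      · cases hΔ
        obtain ⟨a', b', _, _, hm', hr', he', ha, hb, hx⟩ := ih hF' hH hn hr₂
        obtain ⟨_, _, hs, hx₁, hx₂⟩ := hx.split hF
        obtain ⟨_, hs₁, hs₂⟩ := hs.assoc_symm hm'
        exact ⟨_, _, _, _, hs₂, .app1 hs₁.symm (hr₁.ext hx₁) hr',
          (Erase.app1 hf he' .nil).conv_of_ltyped he.ltyped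
            ((Conv.subst1_left (CStep.lred ha) B).symm.trans hc),
          CStep.red_appR _ ha, CStep.red_appR _ hb, hx₂⟩
  | beta0 hl =>
    intro H₁ H₂ a b A hm hH he hr
    cases hr with
    | app0 hr =>
      cases hr with
      | ptr hl₁ hr =>
        obtain ⟨rfl, hm'⟩ := hl.merge hm hl₁
        have hH' := (hH.left hm).lookup hl₁
        cases hr with
        | lam0 _ hr =>
          obtain ⟨f, n, X, B, t, rfl, -, hf, hn, hc⟩ |
            ⟨f, n, X, B, t, Δ₁, Δ₂, rfl, hf, hn, hΔ, hc⟩ := he.app_inv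
          · obtain ⟨X', ma, B', rfl, hma, hc'⟩ := hf.lam0_inv
            obtain ⟨rfl, hX, hB⟩ := hc'.pi0_inj
            cases hma.pwf with
            | consN _ hX' =>
              have hs := hma.subst1_none (.conv hn hX' hX.symm) (q := .box) trivial
              refine ⟨_, _, _, _, hm', ?_, hs.conv_of_ltyped he.ltyped
                (Conv.trans ?_ hc), .single .beta0, .single .beta0, .refl _⟩
              · simp only [subst1_eq]
                exact hr.subst_absent hH' (k := 0) (hma.absent rfl)
              · simp only [subst1_eq]
                exact hB.subst _
          · exact absurd hn Erase.not_box
    | app1 hm₁ hr₁ hr₂ =>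
      obtain ⟨F, hF, hF'⟩ := hm₁.assoc hm
      cases hr₁ with
      | ptr hl₁ hr₁ =>
        obtain ⟨rfl, -⟩ := hl.merge hF' hl₁
        cases hr₁ with
        | lam0 _ hr =>
          obtain ⟨f, n, X, B, t, rfl, rfl, hf, hn, hc⟩ |
            ⟨f, n, X, B, t, Δ₁, Δ₂, rfl, hf, hn, hΔ, hc⟩ := he.app_inv
          · exact absurd hr₂ Resolve.not_box
          · obtain ⟨_, _, _, _, _, hc'⟩ := hf.lam0_inv
            exact absurd hc' Conv.not_pi0_pi1
  | beta1 hl =>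
    intro H₁ H₂ a b A hm hH he hr
    cases hr with
    | app1 hm₁ hr₁ hr₂ =>
      obtain ⟨F, hF, hF'⟩ := hm₁.assoc hm
      cases hr₁ with
      | ptr hl₁ hr₁ =>
        obtain ⟨rfl, hm'⟩ := hl.merge hF' hl₁
        obtain ⟨H₁', hs₁, hs₂⟩ := hF.assoc_symm hm'
        have hH₁ := (hH.left hF').lookup hl₁
        have hH₂ := (hH.left hm).left hm₁.symm
        cases hr₁ with
        | lam1 _ hr =>
          obtain ⟨f, n, X, B, t, rfl, rfl, hf, hn, hc⟩ |
            ⟨f, n, X, B, t, Δ₁, Δ₂, rfl, hf, hn, hΔ, hc⟩ := he.app_inv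
          · exact absurd hr₂ Resolve.not_box
          · cases hΔ
            obtain ⟨X', ma, B', s, rfl, hma, hc'⟩ := hf.lam1_inv
            obtain ⟨rfl, hX, hB⟩ := hc'.pi1_inj
            cases hma.pwf with
            | cons _ hX' =>
              have hn' := Erase.conv hn hX' hX.symm
              obtain ⟨t', mg, hg, hU⟩ := hr₂.ptr_lam hH₂
              have ht : t' = s := by
                rcases hg with rfl | rfl
                · obtain ⟨_, _, _, _, _, hY⟩ := hn'.lam0_inv
                  exact hX'.srt_eq_of_conv_pi0 hY
                · obtain ⟨_, _, _, _, _, _, hY⟩ := hn'.lam1_inv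
                  exact hX'.srt_eq_of_conv_pi1 hY
              have hv : ∀ g, g = .lam0 t' .box mg ∨ g = .lam1 t' .box mg → Value g := by
                rintro _ (rfl | rfl)
                · exact .lam0
                · exact .lam1
              subst ht
              refine ⟨_, _, _, _, hs₂, ?_, (hma.subst1_some hn').conv_of_ltyped he.ltyped
                (Conv.trans ?_ hc), ?_, .single (.beta1 (hv _ hg)), .refl _⟩
              · simp only [subst1_eq]
                cases t' with
                | L => exact hr.subst_once hr₂ trivial hn.closed hs₁ hH₁ (k := 0) (hma.once rfl)
                | U =>
                  cases hs₁.eq_left hU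
                  exact hr.subst_unrestricted hr₂ trivial hn.closed hU (k := 0) hs₁ hH₁
              · simp only [subst1_eq]
                exact hB.subst _
              · refine .single (.beta1 ?_)
                rcases hg with rfl | rfl
                · obtain ⟨_, _, _, rfl, _⟩ := hn'.lam0_inv
                  exact .lam0
                · obtain ⟨_, _, _, _, rfl, _⟩ := hn'.lam1_inv
                  exact .lam1

/-- Heap subject reduction. -/
theorem heap_subject_reduction {H H' : Heap} {a b c c' A : Tm}
    (hwr : WellResolved H a b c A) (hH : WrHeap H)
    (hr : HStep H c H' c') :
    ∃ a' b' : Tm, WellResolved H' a' b' c' A ∧ WrHeap H' ∧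
      Relation.ReflTransGen CStep a a' ∧ Relation.ReflTransGen CStep b b' := by
  obtain ⟨he, hres⟩ := hwr
  obtain ⟨K, hK, hU⟩ := HMerge.exists_unrestricted H
  obtain ⟨a', b', H₁, K', hm, hr', he', ha, hb, hx⟩ := hr.simulation hK hH.heapOK he hres
  obtain rfl := hm.eq_left (hx.restr hU)
  exact ⟨a', b', ⟨he', hr'⟩, hr.wrHeap hH ((hres.closed_iff hH.heapOK 0).2 he.closed), ha, hb⟩
end TLL
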